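/- arXiv:math/0306170 — 5 statements merged into one kernel-verified Lean document; each statement's English description precedes it below -/
import Mathlib

section
/- Let n ≥ 1 and m₁, m₂ ≥ 1. Let A₁ be the Airy connection of bidegree (n, m₁) built from coefficients a₁, …, a_{n−1} ∈ ℂ and b₀, …, b_{m₁} ∈ ℂ with b_{m₁} ≠ 0, and let A₂ be the Airy connection of bidegree (n, m₂) built from coefficients d₁, …, d_{n−1} ∈ ℂ and h₀, …, h_{m₂} ∈ ℂ with h_{m₂} ≠ 0. If A₁ and A₂ are formally equivalent over ℂ((z)), then m₁ = m₂. -/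
open scoped BigOperators

/-- Formal derivative on the field `ℂ((z))` of formal Laurent series:
`∑ cₖ zᵏ ↦ ∑ k cₖ z^(k-1)`. -/
noncomputable def lsDeriv (f : LaurentSeries ℂ) : LaurentSeries ℂ where
  coeff k := ((k + 1 : ℤ) : ℂ) * f.coeff (k + 1)
  isPWO_support' := by
    have h : (Function.support fun k : ℤ => ((k + 1 : ℤ) : ℂ) * f.coeff (k + 1)) ⊆
        (fun k : ℤ => k - 1) '' (Function.support f.coeff) := by
      intro k hk
      refine ⟨k + 1, fun h0 => ?_, by ring⟩
      simp [Function.mem_support, h0] at hk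
    exact ((f.isPWO_support').image_of_monotone (fun x y hxy => by omega)).mono h

/-- Entrywise formal derivative of a matrix over `ℂ((z))`. -/
noncomputable def matDeriv {n : ℕ} (M : Matrix (Fin n) (Fin n) (LaurentSeries ℂ)) :
    Matrix (Fin n) (Fin n) (LaurentSeries ℂ) :=
  Matrix.of fun i j => lsDeriv (M i j)

/-- Two connection matrices are formally equivalent over `ℂ((z))` if there is an invertible
`P ∈ GLₙ(ℂ((z)))` with `A₂ = P⁻¹ A₁ P − P⁻¹ P′`. -/
def FormallyEquiv {n : ℕ} (A₁ A₂ : Matrix (Fin n) (Fin n) (LaurentSeries ℂ)) : Prop :=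
  ∃ P : (Matrix (Fin n) (Fin n) (LaurentSeries ℂ))ˣ,
    A₂ = (↑P⁻¹ : Matrix (Fin n) (Fin n) (LaurentSeries ℂ)) * A₁
          * (↑P : Matrix (Fin n) (Fin n) (LaurentSeries ℂ))
      - (↑P⁻¹ : Matrix (Fin n) (Fin n) (LaurentSeries ℂ))
          * matDeriv (↑P : Matrix (Fin n) (Fin n) (LaurentSeries ℂ))

/-- The Airy connection of bidegree `(n, m)` in the coordinate `z = 1/x` (0-indexed):
`A i (i+1) = z⁻²` for `i+1 ≤ n-1`, `A (n-1) 0 = z⁻² ∑_{j=0}^m b_j z^(-j)`,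
`A (n-1) k = a_k z⁻²` for `1 ≤ k ≤ n-1`, all other entries `0`. -/
noncomputable def airyConn (n m : ℕ) (a b : ℕ → ℂ) :
    Matrix (Fin n) (Fin n) (LaurentSeries ℂ) :=
  Matrix.of fun i j =>
    if (i : ℕ) + 1 = n then
      if (j : ℕ) = 0 then
        ∑ k ∈ Finset.range (m + 1), HahnSeries.single (-2 - (k : ℤ)) (b k)
      else HahnSeries.single (-2 : ℤ) (a (j : ℕ))
    else if (i : ℕ) + 1 = (j : ℕ) then HahnSeries.single (-2 : ℤ) (1 : ℂ)
    else 0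

theorem lsDeriv_coeff (f : LaurentSeries ℂ) (k : ℤ) :
    (lsDeriv f).coeff k = ((k + 1 : ℤ) : ℂ) * f.coeff (k + 1) := rfl

theorem lsDeriv_sum {ι : Type*} (s : Finset ι) (f : ι → LaurentSeries ℂ) :
    lsDeriv (∑ i ∈ s, f i) = ∑ i ∈ s, lsDeriv (f i) := by
  ext k
  simp [lsDeriv_coeff, HahnSeries.coeff_sum, Finset.mul_sum]

/-- The Euler derivation `z d/dz` on `ℂ((z))`. -/
noncomputable def lsEuler (f : LaurentSeries ℂ) : LaurentSeries ℂ where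
  coeff k := (k : ℂ) * f.coeff k
  isPWO_support' := f.isPWO_support'.mono fun k hk h0 => hk (by simp [h0])

theorem lsEuler_coeff (f : LaurentSeries ℂ) (k : ℤ) :
    (lsEuler f).coeff k = (k : ℂ) * f.coeff k := rfl

theorem support_lsEuler_subset (f : LaurentSeries ℂ) : (lsEuler f).support ⊆ f.support :=
  fun k hk h0 => hk (by simp [lsEuler_coeff, h0])

theorem lsEuler_mul (f g : LaurentSeries ℂ) :
    lsEuler (f * g) = lsEuler f * g + f * lsEuler g := by
  ext k
  rw [lsEuler_coeff, HahnSeries.coeff_add,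
    HahnSeries.coeff_mul_left' f.isPWO_support (support_lsEuler_subset f),
    HahnSeries.coeff_mul_right' g.isPWO_support (support_lsEuler_subset g),
    HahnSeries.coeff_mul, Finset.mul_sum, ← Finset.sum_add_distrib]
  refine Finset.sum_congr rfl fun ij hij => ?_
  have hk : ij.1 + ij.2 = k := by
    simpa using (Finset.mem_antidiagonal.1 hij).2.2
  rw [lsEuler_coeff, lsEuler_coeff, ← hk]
  push_cast
  ring

theorem lsDeriv_eq_single_mul_lsEuler (f : LaurentSeries ℂ) :
    lsDeriv f = HahnSeries.single (-1 : ℤ) (1 : ℂ) * lsEuler f := by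
  ext k
  have := HahnSeries.coeff_single_mul_add (r := (1 : ℂ)) (x := lsEuler f) (a := k + 1) (b := -1)
  rw [add_neg_cancel_right, one_mul] at this
  rw [this, lsDeriv_coeff, lsEuler_coeff]

theorem lsDeriv_mul (f g : LaurentSeries ℂ) :
    lsDeriv (f * g) = lsDeriv f * g + f * lsDeriv g := by
  simp only [lsDeriv_eq_single_mul_lsEuler, lsEuler_mul]
  ring

/-- `N` times the order of the Laurent series `f` is at least `s`. -/
def OrdGE (N s : ℤ) (f : LaurentSeries ℂ) : Prop :=
  ∀ k : ℤ, N * k < s → f.coeff k = 0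

namespace OrdGE

variable {N s t : ℤ} {f g : LaurentSeries ℂ}

theorem mono (hst : s ≤ t) (hf : OrdGE N t f) : OrdGE N s f :=
  fun k hk => hf k (hk.trans_le hst)

theorem zero : OrdGE N s 0 := fun _ _ => rfl

theorem add (hf : OrdGE N s f) (hg : OrdGE N s g) : OrdGE N s (f + g) := fun k hk => by
  simp [hf k hk, hg k hk]

theorem sub (hf : OrdGE N s f) (hg : OrdGE N s g) : OrdGE N s (f - g) := fun k hk => by
  simp [hf k hk, hg k hk]

theorem sum {ι : Type*} {S : Finset ι} {F : ι → LaurentSeries ℂ}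
    (hF : ∀ i ∈ S, OrdGE N s (F i)) : OrdGE N s (∑ i ∈ S, F i) := fun k hk => by
  rw [HahnSeries.coeff_sum]
  exact Finset.sum_eq_zero fun i hi => hF i hi k hk

theorem mul (hf : OrdGE N s f) (hg : OrdGE N t g) : OrdGE N (s + t) (f * g) := fun k hk => by
  rw [HahnSeries.coeff_mul]
  refine Finset.sum_eq_zero fun ij hij => ?_
  have hij : ij.1 + ij.2 = k := by
    simpa using (Finset.mem_antidiagonal.1 hij).2.2
  rcases lt_or_ge (N * ij.1) s with h1 | h1
  · rw [hf _ h1, zero_mul]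
  · rw [hg ij.2 (by rw [← hij, mul_add] at hk; linarith), mul_zero]

theorem single {e : ℤ} {r : ℂ} (he : s ≤ N * e) : OrdGE N s (HahnSeries.single e r) :=
  fun k hk => HahnSeries.coeff_single_of_ne (by rintro rfl; omega)

theorem lsDeriv (hf : OrdGE N s f) : OrdGE N (s - N) (lsDeriv f) := fun k hk => by
  rw [lsDeriv_coeff, hf (k + 1) (by linarith), mul_zero]

theorem of_single_mul {e : ℤ} {r : ℂ} (hr : r ≠ 0)
    (h : OrdGE N (s + N * e) (HahnSeries.single e r * f)) : OrdGE N s f := fun k hk => by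
  have := h (k + e) (by linarith)
  rw [HahnSeries.coeff_single_mul_add] at this
  exact (mul_eq_zero.1 this).resolve_left hr

end OrdGE

theorem exists_ordGE {N : ℤ} (hN : 0 ≤ N) (f : LaurentSeries ℂ) : ∃ s, OrdGE N s f :=
  ⟨N * f.order, fun _ hk =>
    HahnSeries.coeff_eq_zero_of_lt_order (lt_of_mul_lt_mul_left hk hN)⟩

theorem exists_ordGE_forall {ι : Type*} [Finite ι] {N : ℤ} (hN : 0 ≤ N)
    (F : ι → LaurentSeries ℂ) : ∃ s, ∀ i, OrdGE N s (F i) := by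
  choose s hs using fun i => exists_ordGE hN (F i)
  obtain ⟨c, hc⟩ := (Set.finite_range s).bddBelow
  exact ⟨c, fun i => (hs i).mono (hc ⟨i, rfl⟩)⟩

/-- The operator `A - d/dz` on column vectors over `ℂ((z))`. -/
noncomputable def connOp {n : ℕ} (A : Matrix (Fin n) (Fin n) (LaurentSeries ℂ))
    (v : Fin n → LaurentSeries ℂ) : Fin n → LaurentSeries ℂ :=
  fun i => ∑ j, A i j * v j - lsDeriv (v i)

theorem connOp_mulVec {n : ℕ} {A B P : Matrix (Fin n) (Fin n) (LaurentSeries ℂ)}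
    (h : P * B = A * P - matDeriv P) (v : Fin n → LaurentSeries ℂ) :
    connOp A (P.mulVec v) = P.mulVec (connOp B v) := by
  have hB : ∀ u, connOp B u = B.mulVec u - fun i => lsDeriv (u i) := fun u => rfl
  have hA : ∀ u, connOp A u = A.mulVec u - fun i => lsDeriv (u i) := fun u => rfl
  have hd : (fun i => lsDeriv (P.mulVec v i)) =
      (matDeriv P).mulVec v + P.mulVec fun i => lsDeriv (v i) := by
    funext i
    simp [Matrix.mulVec, dotProduct, matDeriv, lsDeriv_sum, lsDeriv_mul, Finset.sum_add_distrib]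
  rw [hA, hB, hd, Matrix.mulVec_sub, Matrix.mulVec_mulVec, Matrix.mulVec_mulVec, h,
    Matrix.sub_mulVec]
  abel

/-- `A` lowers the order weighted by `ω` by at most `D`. -/
def LowersAtMost {n : ℕ} (N D : ℤ) (ω : Fin n → ℤ)
    (A : Matrix (Fin n) (Fin n) (LaurentSeries ℂ)) : Prop :=
  ∀ i j, OrdGE N (ω j - ω i - D) (A i j)

/-- Every column of `A` has an entry whose leading monomial lowers the order weighted by `ω` by
exactly `D` and strictly dominates the rest of its row. -/
def HasPivots {n : ℕ} (N D : ℤ) (ω : Fin n → ℤ)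
    (A : Matrix (Fin n) (Fin n) (LaurentSeries ℂ)) : Prop :=
  ∀ j₀, ∃ i, ∃ (e : ℤ) (r : ℂ), r ≠ 0 ∧ N * e = ω j₀ - ω i - D ∧
    OrdGE N (ω j₀ - ω i - D + 1) (A i j₀ - HahnSeries.single e r) ∧
    ∀ j ≠ j₀, OrdGE N (ω j - ω i - D + 1) (A i j)

/-- All components of `v` have weighted order at least `c`. -/
def VecOrdGE {n : ℕ} (N : ℤ) (ω : Fin n → ℤ) (c : ℤ) (v : Fin n → LaurentSeries ℂ) : Prop :=
  ∀ i, OrdGE N (c - ω i) (v i)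

theorem exists_vecOrdGE {n : ℕ} {N : ℤ} (hN : 0 ≤ N) (ω : Fin n → ℤ)
    (v : Fin n → LaurentSeries ℂ) : ∃ c, VecOrdGE N ω c v := by
  obtain ⟨s, hs⟩ := exists_ordGE_forall hN v
  obtain ⟨t, ht⟩ := (Set.finite_range ω).bddBelow
  exact ⟨s + t, fun i => (hs i).mono (by have := ht ⟨i, rfl⟩; linarith)⟩

theorem exists_vecOrdGE_mulVec {n : ℕ} {N : ℤ} (hN : 0 ≤ N) (ω₁ ω₂ : Fin n → ℤ)
    (Q : Matrix (Fin n) (Fin n) (LaurentSeries ℂ)) :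
    ∃ C, ∀ c v, VecOrdGE N ω₁ c v → VecOrdGE N ω₂ (c + C) (Q.mulVec v) := by
  obtain ⟨s, hs⟩ := exists_ordGE_forall hN fun p : Fin n × Fin n => Q p.1 p.2
  obtain ⟨t, ht⟩ := (Set.finite_range ω₂).bddBelow
  obtain ⟨u, hu⟩ := (Set.finite_range ω₁).bddAbove
  refine ⟨s + t - u, fun c v hv i => OrdGE.sum fun j _ => ((hs (i, j)).mul (hv j)).mono ?_⟩
  have h₁ := ht ⟨i, rfl⟩
  have h₂ := hu ⟨j, rfl⟩
  linarith

theorem LowersAtMost.connOp {n : ℕ} {N D : ℤ} {ω : Fin n → ℤ}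
    {A : Matrix (Fin n) (Fin n) (LaurentSeries ℂ)} (hA : LowersAtMost N D ω A) (hD : N ≤ D)
    {c : ℤ} {v : Fin n → LaurentSeries ℂ} (hv : VecOrdGE N ω c v) :
    VecOrdGE N ω (c - D) (connOp A v) := fun i =>
  (OrdGE.sum fun j _ => ((hA i j).mul (hv j)).mono (by linarith)).sub
    ((hv i).lsDeriv.mono (by linarith))

theorem LowersAtMost.iterate_connOp {n : ℕ} {N D : ℤ} {ω : Fin n → ℤ}
    {A : Matrix (Fin n) (Fin n) (LaurentSeries ℂ)} (hA : LowersAtMost N D ω A) (hD : N ≤ D)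
    {c : ℤ} {v : Fin n → LaurentSeries ℂ} (hv : VecOrdGE N ω c v) (k : ℕ) :
    VecOrdGE N ω (c - k * D) ((_root_.connOp A)^[k] v) := by
  induction k with
  | zero => simpa using hv
  | succ k ih =>
    rw [Function.iterate_succ_apply']
    convert hA.connOp hD ih using 1
    push_cast
    ring

theorem HasPivots.vecOrdGE_succ {n : ℕ} {N D : ℤ} {ω : Fin n → ℤ}
    {A : Matrix (Fin n) (Fin n) (LaurentSeries ℂ)} (hA : HasPivots N D ω A) (hD : N < D)
    {c : ℤ} {v : Fin n → LaurentSeries ℂ} (hv : VecOrdGE N ω c v)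
    (hAv : VecOrdGE N ω (c + 1 - D) (connOp A v)) : VecOrdGE N ω (c + 1) v := by
  intro j₀
  obtain ⟨i, e, r, hr, he, h₀, h⟩ := hA j₀
  refine OrdGE.of_single_mul (e := e) hr ?_
  have key : HahnSeries.single e r * v j₀ = connOp A v i + lsDeriv (v i) -
      ((A i j₀ - HahnSeries.single e r) * v j₀ + ∑ j ∈ Finset.univ.erase j₀, A i j * v j) := by
    rw [connOp, ← Finset.add_sum_erase _ _ (Finset.mem_univ j₀)]
    ring
  rw [key, he]
  refine (((hAv i).mono ?_).add ((hv i).lsDeriv.mono ?_)).sub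
    (((h₀.mul (hv j₀)).mono ?_).add
      (OrdGE.sum fun j hj => ((h j (Finset.ne_of_mem_erase hj)).mul (hv j)).mono ?_)) <;> linarith

theorem HasPivots.vecOrdGE {n : ℕ} {N D : ℤ} {ω : Fin n → ℤ}
    {A : Matrix (Fin n) (Fin n) (LaurentSeries ℂ)} (hA : HasPivots N D ω A) (hN : 0 ≤ N)
    (hD : N < D) {c : ℤ} {v : Fin n → LaurentSeries ℂ}
    (hAv : VecOrdGE N ω (c - D) (connOp A v)) : VecOrdGE N ω c v := by
  obtain ⟨c₀, hc₀⟩ := exists_vecOrdGE hN ω v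
  rcases le_total c c₀ with hc | hc
  · exact fun i => (hc₀ i).mono (by linarith)
  · induction c, hc using Int.leInduction with
    | base => exact hc₀
    | succ c hc ih =>
      exact hA.vecOrdGE_succ hD (ih fun i => (hAv i).mono (by linarith)) hAv

theorem HasPivots.vecOrdGE_of_iterate {n : ℕ} {N D : ℤ} {ω : Fin n → ℤ}
    {A : Matrix (Fin n) (Fin n) (LaurentSeries ℂ)} (hA : HasPivots N D ω A) (hN : 0 ≤ N)
    (hD : N < D) {v : Fin n → LaurentSeries ℂ} (k : ℕ) {c : ℤ}
    (hAv : VecOrdGE N ω (c - k * D) ((connOp A)^[k] v)) : VecOrdGE N ω c v := by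
  induction k generalizing c with
  | zero => simpa using hAv
  | succ k ih =>
    rw [Function.iterate_succ_apply'] at hAv
    refine ih (hA.vecOrdGE hN hD ?_)
    convert hAv using 1
    push_cast
    ring

/-- A gauge transformation cannot turn a connection lowering weighted orders by at most `D₁` into
one lowering them by exactly some `D₂ > D₁`. -/
theorem HasPivots.le_of_intertwines {n : ℕ} (hn : 0 < n) {N D₁ D₂ : ℤ} {ω₁ ω₂ : Fin n → ℤ}
    {A B P Q : Matrix (Fin n) (Fin n) (LaurentSeries ℂ)} (hB : HasPivots N D₂ ω₂ B)
    (hA : LowersAtMost N D₁ ω₁ A) (hN : 0 ≤ N) (hD₁ : N < D₁) (hQP : Q * P = 1)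
    (hP : ∀ v, connOp A (P.mulVec v) = P.mulVec (connOp B v)) : D₂ ≤ D₁ := by
  by_contra! hlt
  set v : Fin n → LaurentSeries ℂ := fun _ => 1
  obtain ⟨c, hc⟩ := exists_vecOrdGE hN ω₁ (P.mulVec v)
  obtain ⟨C, hC⟩ := exists_vecOrdGE_mulVec hN ω₁ ω₂ Q
  have hbound : ∀ k : ℕ, VecOrdGE N ω₂ (c + C + k * (D₂ - D₁)) v := fun k => by
    refine hB.vecOrdGE_of_iterate hN (hD₁.trans hlt) k ?_
    have hsemi : Function.Semiconj P.mulVec (connOp B) (connOp A) := fun u => (hP u).symm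
    have hk := hC _ _ (hA.iterate_connOp hD₁.le hc k)
    rw [← (hsemi.iterate_right k).eq, Matrix.mulVec_mulVec, hQP, Matrix.one_mulVec] at hk
    convert hk using 1
    ring
  let i : Fin n := ⟨0, hn⟩
  have h1 := hbound (ω₂ i - c - C + 1).toNat i 0 (by
    have := Int.self_le_toNat (ω₂ i - c - C + 1)
    nlinarith)
  simp [v] at h1

section Airy

variable {n m : ℕ} (a b : ℕ → ℂ)

theorem airyConn_lowersAtMost :
    LowersAtMost n (2 * n + m) (fun i => (m * i : ℤ)) (airyConn n m a b) := by
  intro i j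
  have hi : ((i : ℕ) : ℤ) + 1 ≤ n := by exact_mod_cast i.2
  have hj : ((j : ℕ) : ℤ) + 1 ≤ n := by exact_mod_cast j.2
  simp only [airyConn, Matrix.of_apply]
  split_ifs with h₁ h₂ h₂
  · refine OrdGE.sum fun k hk => OrdGE.single ?_
    have hk : (k : ℤ) ≤ m := by exact_mod_cast Finset.mem_range_succ_iff.1 hk
    have h₁ : ((i : ℕ) : ℤ) + 1 = n := by exact_mod_cast h₁
    rw [h₂]
    push_cast
    nlinarith
  · refine OrdGE.single ?_
    have h₁ : ((i : ℕ) : ℤ) + 1 = n := by exact_mod_cast h₁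
    nlinarith
  · refine OrdGE.single ?_
    rw [← h₂]
    push_cast
    linarith
  · exact OrdGE.zero

theorem airyConn_hasPivots (hn : 1 ≤ n) (hm : 1 ≤ m) (hb : b m ≠ 0) :
    HasPivots n (2 * n + m) (fun i => (m * i : ℤ)) (airyConn n m a b) := by
  have hm' : (1 : ℤ) ≤ m := by exact_mod_cast hm
  have hn' : (1 : ℤ) ≤ n := by exact_mod_cast hn
  intro j₀
  rcases Nat.eq_zero_or_pos (j₀ : ℕ) with hj₀ | hj₀
  · refine ⟨⟨n - 1, by omega⟩, -2 - m, b m, hb, ?_, ?_, ?_⟩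
    · simp only [hj₀]
      push_cast [hn]
      ring
    · have hlast : n - 1 + 1 = n := by omega
      simp only [airyConn, Matrix.of_apply, hlast, hj₀, if_true, Finset.sum_range_succ,
        add_sub_cancel_right]
      refine OrdGE.sum fun k hk => OrdGE.single ?_
      have hk : (k : ℤ) + 1 ≤ m := by exact_mod_cast Finset.mem_range.1 hk
      push_cast [hn]
      nlinarith
    · intro j hj
      have hj : (j : ℕ) ≠ 0 := fun h => hj (Fin.ext (h.trans hj₀.symm))
      have hlast : n - 1 + 1 = n := by omega
      simp only [airyConn, Matrix.of_apply, hlast, if_true, if_neg hj]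
      refine OrdGE.single ?_
      have hjn : ((j : ℕ) : ℤ) + 1 ≤ n := by exact_mod_cast j.2
      push_cast [hn]
      nlinarith
  · have hrow : (j₀ : ℕ) - 1 + 1 ≠ n := by have := j₀.2; omega
    have hsucc : (j₀ : ℕ) - 1 + 1 = j₀ := by omega
    refine ⟨⟨j₀ - 1, by omega⟩, -2, 1, one_ne_zero, ?_, ?_, ?_⟩
    · have : 1 ≤ (j₀ : ℕ) := hj₀
      push_cast [this]
      ring
    · simp only [airyConn, Matrix.of_apply, if_neg hrow, if_pos hsucc, sub_self]
      exact OrdGE.zero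
    · intro j hj
      have hj : (j₀ : ℕ) - 1 + 1 ≠ j := fun h => hj (Fin.ext (h.symm.trans hsucc))
      simp only [airyConn, Matrix.of_apply, if_neg hrow, if_neg hj]
      exact OrdGE.zero

end Airy

/-- If two Airy connections of bidegrees `(n, m₁)` and `(n, m₂)` are formally
equivalent over `ℂ((z))`, then `m₁ = m₂`. -/
theorem airy_formallyEquiv_eq_degree
    (n m₁ m₂ : ℕ) (hn : 1 ≤ n) (hm₁ : 1 ≤ m₁) (hm₂ : 1 ≤ m₂)
    (a d : ℕ → ℂ) (b : ℕ → ℂ) (h : ℕ → ℂ) (hb : b m₁ ≠ 0) (hh : h m₂ ≠ 0)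
    (heq : FormallyEquiv (airyConn n m₁ a b) (airyConn n m₂ d h)) :
    m₁ = m₂ := by
  obtain ⟨P, hP⟩ := heq
  set Q : Matrix (Fin n) (Fin n) (LaurentSeries ℂ) := ↑P⁻¹
  have hPQ : (P : Matrix (Fin n) (Fin n) (LaurentSeries ℂ)) * Q = 1 := P.mul_inv
  have hQP : Q * (P : Matrix (Fin n) (Fin n) (LaurentSeries ℂ)) = 1 := P.inv_mul
  have hgauge : (P : Matrix (Fin n) (Fin n) (LaurentSeries ℂ)) * airyConn n m₂ d h =
      airyConn n m₁ a b * P.val - matDeriv P.val := by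
    rw [hP, mul_sub, ← mul_assoc, ← mul_assoc, ← mul_assoc, hPQ, one_mul, one_mul]
  have hcomm := connOp_mulVec hgauge
  have hcomm' : ∀ v, connOp (airyConn n m₂ d h) (Q.mulVec v) =
      Q.mulVec (connOp (airyConn n m₁ a b) v) := fun v => by
    have := congrArg Q.mulVec (hcomm (Q.mulVec v))
    rw [Matrix.mulVec_mulVec, Matrix.mulVec_mulVec, hPQ, hQP, Matrix.one_mulVec,
      Matrix.one_mulVec] at this
    exact this.symm
  have h₂₁ := (airyConn_hasPivots d h hn hm₂ hh).le_of_intertwines hn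
    (airyConn_lowersAtMost a b) (by positivity) (by omega) hQP hcomm
  have h₁₂ := (airyConn_hasPivots a b hn hm₁ hb).le_of_intertwines hn
    (airyConn_lowersAtMost d h) (by positivity) (by omega) hPQ hcomm'
  omega
end

section
/- Let n ≥ 1, q ≥ 1, 0 < r < n and m = qn + r. Let A₁ be the Airy connection of bidegree (n, m) built from coefficients a₁, …, a_{n−1} ∈ ℂ and b₀, …, b_m ∈ ℂ with b_m ≠ 0, and let A₂ be the Airy connection of bidegree (n, m) built from coefficients d₁, …, d_{n−1} ∈ ℂ and h₀, …, h_m ∈ ℂ with h_m ≠ 0. If A₁ and A₂ are formally equivalent over ℂ((z)), then a_{n−1} = d_{n−1} and b_{m−k} = h_{m−k} for every k with 0 ≤ k ≤ q+1. -/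
open scoped BigOperators

/-- A filtration on matrices over `F((z))`: the monomial `z^k` in position `(i, j)` has weight
`(j - i) m - n k`, and all monomials occurring in `M` have weight at most `s`. -/
def WeightLE {F : Type*} [Field F] {n : ℕ} (m : ℕ) (s : ℤ)
    (M : Matrix (Fin n) (Fin n) (LaurentSeries F)) : Prop :=
  ∀ (i j : Fin n) (k : ℤ), s < ((j : ℤ) - (i : ℤ)) * m - n * k → (M i j).coeff k = 0

namespace WeightLE

variable {F : Type*} [Field F] {n m : ℕ} {s t : ℤ} {M N : Matrix (Fin n) (Fin n) (LaurentSeries F)}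

lemma mono (hM : WeightLE m s M) (hst : s ≤ t) : WeightLE m t M :=
  fun i j k hk => hM i j k (hst.trans_lt hk)

lemma zero : WeightLE m s (0 : Matrix (Fin n) (Fin n) (LaurentSeries F)) :=
  fun _ _ _ _ => rfl

lemma add (hM : WeightLE m s M) (hN : WeightLE m s N) : WeightLE m s (M + N) := by
  intro i j k hk
  simp [hM i j k hk, hN i j k hk]

lemma sub (hM : WeightLE m s M) (hN : WeightLE m s N) : WeightLE m s (M - N) := by
  intro i j k hk
  simp [hM i j k hk, hN i j k hk]

lemma sum {ι : Type*} {S : Finset ι} {X : ι → Matrix (Fin n) (Fin n) (LaurentSeries F)}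
    (hX : ∀ x ∈ S, WeightLE m s (X x)) : WeightLE m s (∑ x ∈ S, X x) :=
  Finset.sum_induction X (WeightLE m s) (fun _ _ => add) zero hX

lemma mul (hM : WeightLE m s M) (hN : WeightLE m t N) : WeightLE m (s + t) (M * N) := by
  intro i j k hk
  rw [Matrix.mul_apply, HahnSeries.coeff_sum]
  refine Finset.sum_eq_zero fun l _ => ?_
  rw [HahnSeries.coeff_mul]
  refine Finset.sum_eq_zero fun u hu => ?_
  have huv : u.1 + u.2 = k := (Finset.mem_antidiagonal.mp hu).2.2
  by_cases h1 : s < ((l : ℤ) - (i : ℤ)) * m - n * u.1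
  · rw [hM i l _ h1, zero_mul]
  · rw [hN l j u.2 (by rw [← huv] at hk; linarith), mul_zero]

lemma smul {f : LaurentSeries F} (hf : ∀ k : ℤ, t < -(n * k) → f.coeff k = 0)
    (hM : WeightLE m s M) : WeightLE m (s + t) (f • M) := by
  have hone : WeightLE m t (f • (1 : Matrix (Fin n) (Fin n) (LaurentSeries F))) := by
    intro i j k hk
    rcases eq_or_ne i j with rfl | hij
    · simpa using hf k (by linarith)
    · simp [Matrix.one_apply_ne hij]
  have := hone.mul hM
  rwa [Matrix.smul_mul, Matrix.one_mul, add_comm] at this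

lemma single_smul (c : F) (hM : WeightLE m s M) :
    WeightLE m s (HahnSeries.single (0 : ℤ) c • M) := by
  have := hM.smul (t := 0) (f := HahnSeries.single (0 : ℤ) c) fun k hk =>
    HahnSeries.coeff_single_of_ne (by rintro rfl; simp at hk)
  simpa using this

lemma pow_mul (hM : WeightLE m s M) (hN : WeightLE m t N) (k : ℕ) :
    WeightLE m (t + k * s) (M ^ k * N) := by
  induction k with
  | zero => simpa using hN
  | succ k ih =>
    rw [pow_succ', Matrix.mul_assoc]
    exact (hM.mul ih).mono (by push_cast; linarith)

lemma mul_pow (hM : WeightLE m s M) (hN : WeightLE m t N) (k : ℕ) :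
    WeightLE m (t + k * s) (N * M ^ k) := by
  induction k with
  | zero => simpa using hN
  | succ k ih =>
    rw [pow_succ, ← Matrix.mul_assoc]
    exact (ih.mul hM).mono (by push_cast; linarith)

/-- An approximate intertwining relation propagates to powers. -/
lemma pow_mul_sub_mul_pow {p e : ℤ} {C₁ C₂ P : Matrix (Fin n) (Fin n) (LaurentSeries F)}
    (hC₁ : WeightLE m s C₁) (hC₂ : WeightLE m s C₂)
    (hP : WeightLE m (p + s - e) (C₁ * P - P * C₂)) (k : ℕ) :
    WeightLE m (p + k * s - e) (C₁ ^ k * P - P * C₂ ^ k) := by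
  induction k with
  | zero => simpa using zero
  | succ k ih =>
    have h1 : C₁ ^ (k + 1) * P - P * C₂ ^ (k + 1)
        = C₁ * (C₁ ^ k * P - P * C₂ ^ k) + (C₁ * P - P * C₂) * C₂ ^ k := by
      rw [pow_succ', pow_succ']
      simp only [Matrix.mul_sub, Matrix.sub_mul, Matrix.mul_assoc]
      abel
    rw [h1]
    exact ((hC₁.mul ih).mono (by push_cast; linarith)).add
      ((hC₂.mul_pow hP k).mono (by push_cast; linarith))

/-- A nonzero matrix has a well-defined weight, attained at the order of some entry. -/
lemma exists_eq (hn : 0 < n) (hM : M ≠ 0) : ∃ p : ℤ, WeightLE m p M ∧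
    ∃ i j, M i j ≠ 0 ∧ ((j : ℤ) - (i : ℤ)) * m - n * (M i j).order = p := by
  classical
  let S : Finset (Fin n × Fin n) := Finset.univ.filter fun x => M x.1 x.2 ≠ 0
  have hS : S.Nonempty := by
    by_contra hS
    refine hM (Matrix.ext fun i j => ?_)
    by_contra hij
    exact hS ⟨(i, j), by simpa [S] using hij⟩
  obtain ⟨x, hx, hmax⟩ := S.exists_max_image
    (fun x => ((x.2 : ℤ) - (x.1 : ℤ)) * m - n * (M x.1 x.2).order) hS
  refine ⟨_, fun i j k hk => ?_, x.1, x.2, (Finset.mem_filter.mp hx).2, rfl⟩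
  by_contra hne
  have hij : M i j ≠ 0 := fun h0 => hne (by simp [h0])
  have h1 := hmax (i, j) (by simpa [S] using hij)
  have h2 : (n : ℤ) * (M i j).order ≤ n * k :=
    mul_le_mul_of_nonneg_left (HahnSeries.order_le_of_coeff_ne_zero hne) (by positivity)
  simp only at h1 hk
  linarith

/-- Multiplication by a scalar shifts the weight exactly. -/
lemma coeff_eq_zero_of_smul {p : ℤ} {f : LaurentSeries F} {i j : Fin n} (hij : M i j ≠ 0)
    (hp : ((j : ℤ) - (i : ℤ)) * m - n * (M i j).order = p) (hf : WeightLE m (p + s) (f • M))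
    {k : ℤ} (hk : s < -(n * k)) : f.coeff k = 0 := by
  by_contra hne
  have hf0 : f ≠ 0 := fun h0 => hne (by simp [h0])
  have h2 : (n : ℤ) * f.order ≤ n * k :=
    mul_le_mul_of_nonneg_left (HahnSeries.order_le_of_coeff_ne_zero hne) (by positivity)
  have h1 := hf i j (f * M i j).order (by
    rw [HahnSeries.order_mul hf0 hij]
    linarith)
  exact HahnSeries.coeff_order_eq_zero.not.mpr (mul_ne_zero hf0 hij) h1

end WeightLE

section Companion

variable {F : Type*} [Field F]

/-- The polynomial `∑ⱼ bⱼ xʲ` with `x = z⁻¹`. -/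
noncomputable def xPoly (m : ℕ) (b : ℕ → F) : LaurentSeries F :=
  ∑ k ∈ Finset.range (m + 1), HahnSeries.single (-(k : ℤ)) (b k)

lemma xPoly_coeff_neg {m : ℕ} (b : ℕ → F) {j : ℕ} (hj : j ≤ m) :
    (xPoly m b).coeff (-(j : ℤ)) = b j := by
  simp only [xPoly, HahnSeries.coeff_sum, HahnSeries.coeff_single, neg_inj, Nat.cast_inj]
  rw [Finset.sum_ite_eq, if_pos (by simpa [Nat.lt_succ_iff] using hj)]

lemma xPoly_coeff_eq_zero {m : ℕ} {b : ℕ → F} {k : ℤ}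
    (hb : ∀ j : ℕ, j ≤ m → k = -(j : ℤ) → b j = 0) : (xPoly m b).coeff k = 0 := by
  rw [xPoly, HahnSeries.coeff_sum]
  refine Finset.sum_eq_zero fun j hj => ?_
  rw [HahnSeries.coeff_single]
  split_ifs with h
  · exact hb j (by simpa [Nat.lt_succ_iff] using hj) h
  · rfl

lemma xPoly_sub (m : ℕ) (b h : ℕ → F) :
    xPoly m b - xPoly m h = xPoly m fun j => b j - h j := by
  simp [xPoly, Finset.sum_sub_distrib]

/-- The companion matrix `z² A`, where `A` is the Airy connection. -/
noncomputable def airyCompanion (n m : ℕ) (a b : ℕ → F) :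
    Matrix (Fin n) (Fin n) (LaurentSeries F) :=
  Matrix.of fun i j =>
    if (i : ℕ) + 1 = n then
      if (j : ℕ) = 0 then xPoly m b else HahnSeries.single (0 : ℤ) (a (j : ℕ))
    else if (i : ℕ) + 1 = (j : ℕ) then 1 else 0

lemma weightLE_airyCompanion (n m : ℕ) (a b : ℕ → F) :
    WeightLE m m (airyCompanion n m a b) := by
  intro i j k hk
  have hj : (j : ℤ) + 1 ≤ n := by exact_mod_cast j.isLt
  simp only [airyCompanion, Matrix.of_apply]
  split_ifs with h1 h2 h3
  · refine xPoly_coeff_eq_zero fun l hl hkl => ?_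
    subst hkl
    have hi : (i : ℤ) = n - 1 := by omega
    have hl' : (n : ℤ) * l ≤ n * m := by exact_mod_cast Nat.mul_le_mul_left n hl
    rw [hi, h2] at hk
    push_cast at hk
    linarith
  · refine HahnSeries.coeff_single_of_ne ?_
    rintro rfl
    have hi : (i : ℤ) = n - 1 := by omega
    rw [hi] at hk
    have : ((j : ℤ) - (n - 1)) * m ≤ 0 :=
      mul_nonpos_of_nonpos_of_nonneg (by linarith) (by positivity)
    have hm : (0 : ℤ) ≤ m := by positivity
    linarith
  · rw [HahnSeries.coeff_one, if_neg]
    rintro rfl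
    have : (j : ℤ) - i = 1 := by omega
    rw [this] at hk
    linarith
  · rfl

lemma airyCompanion_row_zero_pow {n m : ℕ} (a b : ℕ → F) (hn : 0 < n) (k : Fin n) (j : Fin n) :
    (airyCompanion n m a b ^ (k : ℕ)) ⟨0, hn⟩ j = if k = j then 1 else 0 := by
  obtain ⟨k, hk⟩ := k
  induction k generalizing j with
  | zero => simp [Matrix.one_apply]
  | succ k ih =>
    rw [pow_succ, Matrix.mul_apply]
    simp only [fun j => ih j (Nat.lt_of_succ_lt hk), ite_mul, one_mul, zero_mul, Finset.sum_ite_eq,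
      Finset.mem_univ, if_true]
    simp only [airyCompanion, Matrix.of_apply, if_neg hk.ne, Fin.ext_iff]

/-- The Cayley–Hamilton relation for the companion matrix. -/
lemma airyCompanion_pow {n : ℕ} (hn : 2 ≤ n) (m : ℕ) (a b : ℕ → F) :
    airyCompanion n m a b ^ n = xPoly m b • 1 +
      ∑ k ∈ Finset.Ico 1 n, HahnSeries.single (0 : ℤ) (a k) • airyCompanion n m a b ^ k := by
  set C := airyCompanion n m a b with hC
  have hn0 : 0 < n := by omega
  set R := xPoly m b • 1 + ∑ k ∈ Finset.Ico 1 n, HahnSeries.single (0 : ℤ) (a k) • C ^ k with hR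
  have hcomm : Commute C R := by
    refine Commute.add_right ((Commute.one_right C).smul_right _) ?_
    exact Commute.sum_right _ _ _ fun k _ => (Commute.self_pow C k).smul_right _
  have hrow : ∀ j, (C ^ n) ⟨0, hn0⟩ j = R ⟨0, hn0⟩ j := by
    intro j
    have hn1 : n - 1 + 1 = n := by omega
    have h1 : (C ^ n) ⟨0, hn0⟩ j = C ⟨n - 1, by omega⟩ j := by
      rw [show C ^ n = C ^ (n - 1) * C by rw [← pow_succ, hn1], Matrix.mul_apply]
      have := airyCompanion_row_zero_pow (m := m) a b hn0 ⟨n - 1, by omega⟩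
      simp only [← hC] at this
      simp [this]
    have h2 : (∑ k ∈ Finset.Ico 1 n, HahnSeries.single (0 : ℤ) (a k) • C ^ k) ⟨0, hn0⟩ j
        = ∑ k ∈ Finset.Ico 1 n, if k = (j : ℕ) then HahnSeries.single (0 : ℤ) (a k) else 0 := by
      rw [Matrix.sum_apply]
      refine Finset.sum_congr rfl fun k hk => ?_
      have := airyCompanion_row_zero_pow (m := m) a b hn0 ⟨k, (Finset.mem_Ico.mp hk).2⟩ j
      simp only [← hC, Fin.ext_iff] at this
      rw [Matrix.smul_apply, this]
      simp
    rw [h1, hR, Matrix.add_apply, h2, Finset.sum_ite_eq', hC]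
    simp only [airyCompanion, Matrix.of_apply, hn1, if_true, Matrix.smul_apply, Matrix.one_apply,
      Fin.ext_iff, Finset.mem_Ico, j.isLt, and_true]
    rcases Nat.eq_zero_or_pos (j : ℕ) with hj | hj
    · simp [hj]
    · simp [hj.ne', hj.ne, Nat.one_le_iff_ne_zero]
  ext1 i j
  have hi : ∀ X : Matrix (Fin n) (Fin n) (LaurentSeries F),
      X i j = (C ^ (i : ℕ) * X) ⟨0, hn0⟩ j := by
    intro X
    have := airyCompanion_row_zero_pow (m := m) a b hn0 i
    simp only [← hC] at this
    simp [Matrix.mul_apply, this]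
  rw [hi (C ^ n), hi R, ← pow_add, add_comm, pow_add, (hcomm.pow_left i).eq, Matrix.mul_apply,
    Matrix.mul_apply]
  simp only [hrow]

/-- If a nonzero matrix intertwines two Airy companion matrices up to an error whose weight is lower
by `n`, as happens for gauge transformations, then the leading coefficients agree. -/
lemma airyCompanion_coeffs_eq {n q r m : ℕ} (hq : 1 ≤ q) (hr0 : 0 < r) (hrn : r < n)
    (hm : m = q * n + r) {a d b h : ℕ → F} (hh : h m ≠ 0)
    {Q : Matrix (Fin n) (Fin n) (LaurentSeries F)} (hQ0 : Q ≠ 0)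
    (hcomm : ∀ p : ℤ, WeightLE m p Q →
      WeightLE m (p - n) (airyCompanion n m a b * Q - Q * airyCompanion n m d h)) :
    a (n - 1) = d (n - 1) ∧ ∀ k : ℕ, k ≤ q + 1 → b (m - k) = h (m - k) := by
  have hn2 : 2 ≤ n := by omega
  have hmn : (n : ℤ) ≤ m := by
    rw [hm]
    push_cast
    nlinarith
  set C₁ := airyCompanion n m a b with hC₁
  set C₂ := airyCompanion n m d h with hC₂
  have hW₁ : WeightLE m m C₁ := weightLE_airyCompanion n m a b
  have hW₂ : WeightLE m m C₂ := weightLE_airyCompanion n m d h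
  obtain ⟨p, hp, i, j, hij, hpij⟩ := WeightLE.exists_eq (m := m) (by omega) hQ0
  have hpow (k : ℕ) : WeightLE m (p + k * m - (n + m)) (C₁ ^ k * Q - Q * C₂ ^ k) :=
    hW₁.pow_mul_sub_mul_pow hW₂ ((hcomm p hp).mono (by linarith)) k
  set δ := a (n - 1) - d (n - 1) with hδ
  set g : LaurentSeries F := xPoly m fun j => b j - h j with hg
  have hn1 : n - 1 + 1 = n := by omega
  have hn1' : ((n - 1 : ℕ) : ℤ) = n - 1 := by omega
  have hrel : WeightLE m (p + (n - 1) * m - n)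
      (g • Q + HahnSeries.single (0 : ℤ) δ • (Q * C₂ ^ (n - 1))) := by
    have hlow : WeightLE m (p + (n - 1) * m - n)
        (∑ k ∈ Finset.Ico 1 (n - 1), (HahnSeries.single (0 : ℤ) (a k) • (C₁ ^ k * Q) -
          HahnSeries.single (0 : ℤ) (d k) • (Q * C₂ ^ k))) := by
      refine WeightLE.sum fun k hk => ?_
      have hk' : (k : ℤ) ≤ n - 2 := by
        have := (Finset.mem_Ico.mp hk).2
        omega
      have hle : p + k * m ≤ p + (n - 1) * m - n := by nlinarith
      exact (((hW₁.pow_mul hp k).mono hle).single_smul _).sub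
        (((hW₂.mul_pow hp k).mono hle).single_smul _)
    have htop : WeightLE m (p + (n - 1) * m - n)
        (HahnSeries.single (0 : ℤ) (a (n - 1)) • (C₁ ^ (n - 1) * Q - Q * C₂ ^ (n - 1))) := by
      have := hpow (n - 1)
      rw [hn1'] at this
      exact (this.mono (by linarith)).single_smul _
    have hsplit (c : ℕ → F) (X : ℕ → Matrix (Fin n) (Fin n) (LaurentSeries F)) :
        ∑ k ∈ Finset.Ico 1 n, HahnSeries.single (0 : ℤ) (c k) • X k
          = ∑ k ∈ Finset.Ico 1 (n - 1), HahnSeries.single (0 : ℤ) (c k) • X k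
            + HahnSeries.single (0 : ℤ) (c (n - 1)) • X (n - 1) := by
      rw [← Finset.sum_Ico_succ_top (by omega), hn1]
    have hid : g • Q + HahnSeries.single (0 : ℤ) δ • (Q * C₂ ^ (n - 1))
        = (C₁ ^ n * Q - Q * C₂ ^ n)
          - (∑ k ∈ Finset.Ico 1 (n - 1), (HahnSeries.single (0 : ℤ) (a k) • (C₁ ^ k * Q) -
              HahnSeries.single (0 : ℤ) (d k) • (Q * C₂ ^ k)))
          - HahnSeries.single (0 : ℤ) (a (n - 1)) • (C₁ ^ (n - 1) * Q - Q * C₂ ^ (n - 1)) := by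
      rw [hC₁, hC₂, airyCompanion_pow hn2, airyCompanion_pow hn2, ← hC₁, ← hC₂, hsplit, hsplit,
        hg, ← xPoly_sub, hδ, HahnSeries.single_sub]
      simp only [Matrix.add_mul, Matrix.mul_add, Matrix.smul_mul, Matrix.mul_smul, Matrix.one_mul,
        Matrix.mul_one, Finset.sum_sub_distrib, Matrix.sum_mul, Matrix.mul_sum, sub_smul, smul_sub]
      abel
    rw [hid]
    exact (((hpow n).mono (by linarith)).sub hlow).sub htop
  have hδ0 : δ = 0 := by
    have hgle : ∀ k : ℤ, (n - 1 : ℤ) * m < -(n * k) → g.coeff k = 0 := by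
      intro k hk
      refine WeightLE.coeff_eq_zero_of_smul hij hpij ?_ hk
      have := (hrel.mono (t := p + (n - 1) * m) (by linarith)).sub
        (((hW₂.mul_pow hp (n - 1)).mono (by rw [hn1'])).single_smul δ)
      rwa [add_sub_cancel_right] at this
    have hglt : ∀ k : ℤ, (n - 1 : ℤ) * m - 1 < -(n * k) → g.coeff k = 0 := by
      intro k hk
      refine hgle k (lt_of_le_of_ne (by linarith) fun heq => ?_)
      have hr : (r : ℤ) = n * (m + k - q) := by
        rw [hm] at heq ⊢
        push_cast at heq ⊢
        linarith
      have := Nat.le_of_dvd hr0 (Int.natCast_dvd_natCast.mp ⟨_, hr⟩)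
      omega
    have hδ₁ : WeightLE m (p + (n - 1) * m - 1)
        (HahnSeries.single (0 : ℤ) δ • (Q * C₂ ^ (n - 1))) := by
      have := (hrel.mono (t := p + (n - 1) * m - 1) (by linarith)).sub
        ((hp.smul hglt).mono (by linarith))
      rwa [add_sub_cancel_left] at this
    have hδ₂ : WeightLE m (p + (n * m - 1)) (HahnSeries.single (0 : ℤ) δ • (Q * C₂ ^ n)) := by
      have := hδ₁.mul hW₂
      rw [Matrix.smul_mul, Matrix.mul_assoc, ← pow_succ, hn1] at this
      exact this.mono (by linarith)
    have hδ₃ : WeightLE m (p + (n * m - 1)) ((HahnSeries.single (0 : ℤ) δ * xPoly m h) • Q) := by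
      have hlow : WeightLE m (p + (n * m - 1)) (HahnSeries.single (0 : ℤ) δ •
          ∑ k ∈ Finset.Ico 1 n, HahnSeries.single (0 : ℤ) (d k) • (Q * C₂ ^ k)) := by
        refine WeightLE.single_smul _ (WeightLE.sum fun k hk => ?_)
        have hk' : (k : ℤ) ≤ n - 1 := by
          have := (Finset.mem_Ico.mp hk).2
          omega
        exact ((hW₂.mul_pow hp k).mono (by nlinarith)).single_smul _
      have := hδ₂.sub hlow
      rw [hC₂, airyCompanion_pow hn2, ← hC₂] at this
      simpa only [Matrix.mul_add, Matrix.mul_smul, Matrix.mul_one, Matrix.mul_sum, smul_add,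
        add_sub_cancel_right, smul_smul] using this
    have := WeightLE.coeff_eq_zero_of_smul hij hpij hδ₃ (k := -(m : ℤ)) (by linarith)
    rw [HahnSeries.coeff_single_zero_mul, xPoly_coeff_neg h le_rfl] at this
    exact (mul_eq_zero.mp this).resolve_right hh
  refine ⟨sub_eq_zero.mp hδ0, fun k hk => ?_⟩
  rw [hδ0, map_zero, zero_smul, add_zero] at hrel
  rw [← sub_eq_zero, ← xPoly_coeff_neg (fun j => b j - h j) (Nat.sub_le m k)]
  refine WeightLE.coeff_eq_zero_of_smul (s := (n - 1) * m - n) hij hpij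
    (hrel.mono (by linarith)) ?_
  have hkm : k ≤ m := by nlinarith
  have hnk : (n : ℤ) * k ≤ n * (q + 1) := by exact_mod_cast Nat.mul_le_mul_left n hk
  have hm' : (m : ℤ) = q * n + r := by exact_mod_cast hm
  have hr0' : (0 : ℤ) < r := by exact_mod_cast hr0
  push_cast [hkm]
  linarith

end Companion

lemma airyCompanion_apply (n m : ℕ) (a b : ℕ → ℂ) (i j : Fin n) :
    airyCompanion n m a b i j = HahnSeries.single (2 : ℤ) (1 : ℂ) * airyConn n m a b i j := by
  simp only [airyConn, airyCompanion, Matrix.of_apply, xPoly]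
  split_ifs
  · rw [Finset.mul_sum]
    refine Finset.sum_congr rfl fun k _ => ?_
    rw [HahnSeries.single_mul_single, one_mul, show (2 : ℤ) + (-2 - k) = -k by ring]
  · simp [HahnSeries.single_mul_single]
  · simp [HahnSeries.single_mul_single]
  · simp

/-- The derivation `z² d/dz` lowers the weight by `n`. -/
lemma WeightLE.of_apply_eq_lsDeriv {n m : ℕ} {s : ℤ}
    {M N : Matrix (Fin n) (Fin n) (LaurentSeries ℂ)} (hM : WeightLE m s M)
    (hN : ∀ i j, N i j = HahnSeries.single (2 : ℤ) (1 : ℂ) * lsDeriv (M i j)) :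
    WeightLE m (s - n) N := by
  intro i j k hk
  have h1 : (M i j).coeff (k - 2 + 1) = 0 := hM i j _ (by linarith)
  have h2 := HahnSeries.coeff_single_mul_add (r := (1 : ℂ)) (x := lsDeriv (M i j))
    (a := k - 2) (b := (2 : ℤ))
  rw [sub_add_cancel] at h2
  rw [hN, h2]
  simp [lsDeriv, h1]

/-- Case `m = qn + r`, `0 < r < n`: if two Airy connections of bidegree `(n, m)` are
formally equivalent over `ℂ((z))`, then `a_{n-1} = d_{n-1}` and `b_{m-k} = h_{m-k}` for
`0 ≤ k ≤ q + 1`. -/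
theorem airy_formallyEquiv_coeffs_of_eq_qn_add_r
    (n q r m : ℕ) (hn : 1 ≤ n) (hq : 1 ≤ q) (hr0 : 0 < r) (hrn : r < n)
    (hm : m = q * n + r)
    (a d : ℕ → ℂ) (b : ℕ → ℂ) (h : ℕ → ℂ) (hb : b m ≠ 0) (hh : h m ≠ 0)
    (heq : FormallyEquiv (airyConn n m a b) (airyConn n m d h)) :
    a (n - 1) = d (n - 1) ∧ ∀ k : ℕ, k ≤ q + 1 → b (m - k) = h (m - k) := by
  obtain ⟨P, hP⟩ := heq
  have : Nonempty (Fin n) := ⟨⟨0, hn⟩⟩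
  have hmul : (P : Matrix (Fin n) (Fin n) (LaurentSeries ℂ)) * airyConn n m d h
      = airyConn n m a b * P - matDeriv (P : Matrix (Fin n) (Fin n) (LaurentSeries ℂ)) := by
    rw [hP, Matrix.mul_sub, ← Matrix.mul_assoc, ← Matrix.mul_assoc, ← Matrix.mul_assoc]
    simp
  refine airyCompanion_coeffs_eq hq hr0 hrn hm hh P.ne_zero fun p hp =>
    hp.of_apply_eq_lsDeriv fun i j => ?_
  have hij := congrFun (congrFun hmul i) j
  simp only [Matrix.sub_apply, Matrix.mul_apply, matDeriv, Matrix.of_apply] at hij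
  simp only [Matrix.sub_apply, Matrix.mul_apply, airyCompanion_apply, mul_assoc,
    mul_left_comm _ (HahnSeries.single (2 : ℤ) (1 : ℂ)), ← Finset.mul_sum]
  rw [hij, ← mul_sub, sub_sub_cancel]
end

section
/- Let m ≥ 2, q ≥ 1, 0 < r < m and n = qm + r. Let A₁ be the Airy connection of bidegree (n, m) built from coefficients a₁, …, a_{n−1} ∈ ℂ and b₀, …, b_m ∈ ℂ with b_m ≠ 0, and let A₂ be the Airy connection of bidegree (n, m) built from coefficients d₁, …, d_{n−1} ∈ ℂ and h₀, …, h_m ∈ ℂ with h_m ≠ 0. If A₁ and A₂ are formally equivalent over ℂ((z)), then b_m = h_m, b_{m−1} = h_{m−1}, and a_{n−k} = d_{n−k} for every k with 1 ≤ k ≤ q+1. -/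
open scoped BigOperators

/-- The companion matrix with last row `c`. -/
def lastRowCompanion {S : Type*} [CommRing S] {n : ℕ} (c : Fin n → S) :
    Matrix (Fin n) (Fin n) S :=
  Matrix.of fun i j =>
    if (i : ℕ) + 1 = n then c j else if (i : ℕ) + 1 = (j : ℕ) then 1 else 0

section Companion

variable {S : Type*} [CommRing S] {n : ℕ}

lemma lastRowCompanion_mulVec_last (c w : Fin n → S) {i : Fin n} (hi : (i : ℕ) + 1 = n) :
    (lastRowCompanion c).mulVec w i = ∑ k, c k * w k := by
  simp [lastRowCompanion, Matrix.mulVec, dotProduct, hi]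

lemma lastRowCompanion_mulVec_succ (c w : Fin n → S) {i : ℕ} (hi : i + 1 < n) :
    (lastRowCompanion c).mulVec w ⟨i, by omega⟩ = w ⟨i + 1, hi⟩ := by
  rw [Matrix.mulVec, dotProduct, Finset.sum_eq_single ⟨i + 1, hi⟩]
  · simp [lastRowCompanion, hi.ne]
  · intro k _ hk
    have : i + 1 ≠ (k : ℕ) := fun h => hk (Fin.ext h.symm)
    simp [lastRowCompanion, hi.ne, this]
  · simp

lemma lastRowCompanion_mulVec_pow (c : Fin n → S) {y : S}
    (hy : y ^ n = ∑ k, c k * y ^ (k : ℕ)) :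
    (lastRowCompanion c).mulVec (fun j => y ^ (j : ℕ)) = y • fun j : Fin n => y ^ (j : ℕ) := by
  ext ⟨i, hi⟩
  by_cases hin : i + 1 = n
  · rw [lastRowCompanion_mulVec_last _ _ hin, ← hy, Pi.smul_apply, smul_eq_mul, ← pow_succ',
      hin]
  · rw [lastRowCompanion_mulVec_succ _ _ (by omega)]
    simp [pow_succ']

lemma eq_pow_mul_of_lastRowCompanion_mulVec (c w : Fin n → S) {y : S} (hn : 0 < n)
    (hw : (lastRowCompanion c).mulVec w = y • w) (i : ℕ) (hi : i < n) :
    w ⟨i, hi⟩ = y ^ i * w ⟨0, hn⟩ := by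
  induction i with
  | zero => simp
  | succ i ih =>
    rw [← lastRowCompanion_mulVec_succ c w hi, hw, Pi.smul_apply, ih, smul_eq_mul, pow_succ']
    ring

/-- If an intertwiner of two companion matrices sends the eigenvector `(y ^ j)` to a vector with
a unit coordinate, then `y` is a root of both characteristic polynomials. -/
lemma pow_eq_sum_of_intertwines (c c' : Fin n → S) (Q : Matrix (Fin n) (Fin n) S)
    (hQ : lastRowCompanion c * Q = Q * lastRowCompanion c') {y : S}
    (hy : y ^ n = ∑ k, c' k * y ^ (k : ℕ)) (i : Fin n)
    (hu : IsUnit (Q.mulVec (fun j => y ^ (j : ℕ)) i)) :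
    y ^ n = ∑ k, c k * y ^ (k : ℕ) := by
  have hn : 0 < n := i.pos
  set w := Q.mulVec (fun j => y ^ (j : ℕ)) with hwdef
  have hw : (lastRowCompanion c).mulVec w = y • w := by
    rw [hwdef, Matrix.mulVec_mulVec, hQ, ← Matrix.mulVec_mulVec,
      lastRowCompanion_mulVec_pow c' hy, Matrix.mulVec_smul]
  have hpow := eq_pow_mul_of_lastRowCompanion_mulVec c w hn hw
  have hu0 : IsUnit (w ⟨0, hn⟩) := by
    have h := hpow i i.2
    rw [Fin.eta] at h
    exact isUnit_of_mul_isUnit_right (h ▸ hu)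
  refine hu0.mul_right_cancel ?_
  have hlast := congrFun hw ⟨n - 1, by omega⟩
  rw [lastRowCompanion_mulVec_last _ _ (by simp only; omega), Pi.smul_apply,
    hpow (n - 1) (by omega), smul_eq_mul, ← mul_assoc, ← pow_succ', Nat.sub_add_cancel hn]
    at hlast
  rw [← hlast, Finset.sum_mul]
  refine Finset.sum_congr rfl fun k _ => ?_
  rw [mul_assoc, ← hpow k k.2]

end Companion

/-- A nonzero vector of length `n`, read as a polynomial, does not vanish at some `n`-th root of
`β`. -/
lemma exists_pow_eq_sum_mul_pow_ne_zero {n : ℕ} {β : ℂ} (hβ : β ≠ 0) (p : Fin n → ℂ)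
    (hp : p ≠ 0) : ∃ ρ : ℂ, ρ ^ n = β ∧ ∑ j, p j * ρ ^ (j : ℕ) ≠ 0 := by
  by_contra! hcon
  obtain ⟨j₀, hj₀⟩ := Function.ne_iff.mp hp
  have hn : 0 < n := j₀.pos
  let f : Polynomial ℂ := ∑ j : Fin n, Polynomial.C (p j) * Polynomial.X ^ (j : ℕ)
  have hcoeff : f.coeff j₀ = p j₀ := by
    simp [f, Polynomial.coeff_C_mul, Polynomial.coeff_X_pow,
      Fin.val_inj]
  have hf : f.natDegree < n := by
    refine lt_of_le_of_lt (Polynomial.natDegree_sum_le_of_forall_le (n := n - 1) _ _ ?_) (by omega)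
    intro j _
    exact (Polynomial.natDegree_C_mul_X_pow_le _ _).trans (by omega)
  have hsep : (Polynomial.X ^ n - Polynomial.C β).Separable :=
    Polynomial.separable_X_pow_sub_C β (by exact_mod_cast hn.ne') hβ
  have hcard := Polynomial.card_rootSet_eq_natDegree (K := ℂ) hsep
    (IsAlgClosed.splits _)
  rw [Polynomial.natDegree_X_pow_sub_C] at hcard
  have hzero : f = 0 := by
    refine Polynomial.eq_zero_of_natDegree_lt_card_of_eval_eq_zero f
      (Subtype.val_injective (p := (· ∈ (Polynomial.X ^ n - Polynomial.C β).rootSet ℂ))) ?_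
      (hcard ▸ hf)
    intro x
    have hx := (Polynomial.mem_rootSet.mp x.2).2
    simp only [map_sub, map_pow, Polynomial.aeval_X, Polynomial.aeval_C, sub_eq_zero] at hx
    simpa [f, Polynomial.eval_finsetSum] using hcon _ hx
  rw [hzero] at hcoeff
  exact hj₀ hcoeff.symm

section PowerSeriesRoots

open PowerSeries

/-- Hensel lifting of a nonzero `n`-th root `ρ` to a root of a perturbation of `y ^ n = ρ ^ n`. -/
lemma exists_powerSeries_root {n : ℕ} (hn : 0 < n) (c : Fin n → ℂ⟦X⟧) {ρ : ℂ} (hρ : ρ ≠ 0)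
    (hc0 : constantCoeff (c ⟨0, hn⟩) = ρ ^ n)
    (hc : ∀ k : Fin n, k ≠ ⟨0, hn⟩ → constantCoeff (c k) = 0) :
    ∃ y : ℂ⟦X⟧, constantCoeff y = ρ ∧ y ^ n = ∑ k, c k * y ^ (k : ℕ) := by
  let g : Polynomial ℂ⟦X⟧ := ∑ k : Fin n, Polynomial.C (c k) * Polynomial.X ^ (k : ℕ)
  let f : Polynomial ℂ⟦X⟧ := Polynomial.X ^ n - g
  have hmonic : f.Monic := by
    refine Polynomial.monic_X_pow_sub ?_
    refine (Polynomial.degree_sum_fin_lt c)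
  have hmap : f.map (constantCoeff (R := ℂ)) = Polynomial.X ^ n - Polynomial.C (ρ ^ n) := by
    simp only [f, g, Polynomial.map_sub, Polynomial.map_pow, Polynomial.map_X,
      Polynomial.map_sum, Polynomial.map_mul, Polynomial.map_C]
    rw [Finset.sum_eq_single ⟨0, hn⟩ (fun k _ hk => by rw [hc k hk]; simp) (by simp), hc0]
    simp
  have hev : ∀ p : Polynomial ℂ⟦X⟧, constantCoeff (p.eval (C ρ)) =
      (p.map (constantCoeff (R := ℂ))).eval ρ := by
    intro p
    rw [Polynomial.eval_map, Polynomial.eval, Polynomial.hom_eval₂]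
    simp
  have hmem : ∀ x : ℂ⟦X⟧, x ∈ Ideal.span {(X : ℂ⟦X⟧)} ↔ constantCoeff x = 0 := fun x => by
    rw [Ideal.mem_span_singleton, X_dvd_iff]
  obtain ⟨y, hy, hyρ⟩ := HenselianRing.is_henselian (I := Ideal.span {(X : ℂ⟦X⟧)}) f hmonic (C ρ)
    (by rw [hmem, hev, hmap]; simp)
    (by
      refine IsUnit.map _ (isUnit_iff_constantCoeff.mpr ?_)
      rw [hev, ← Polynomial.derivative_map, hmap, isUnit_iff_ne_zero]
      rw [Polynomial.derivative_sub, Polynomial.derivative_C, Polynomial.derivative_X_pow]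
      simp [hρ, hn.ne'])
  refine ⟨y, ?_, ?_⟩
  · rw [hmem] at hyρ
    simpa [sub_eq_zero] using hyρ
  · simpa [f, g, Polynomial.IsRoot, Polynomial.eval_finsetSum, sub_eq_zero] using hy

/-- Terms of distinct orders below `N` cannot cancel modulo `X ^ N`. -/
lemma eq_zero_of_X_pow_dvd_sum {ι : Type*} [Fintype ι] (γ : ι → ℂ) (e : ι → ℕ) (u : ι → ℂ⟦X⟧)
    (hu : ∀ l, constantCoeff (u l) ≠ 0) (N : ℕ)
    (he : ∀ l l', e l < N → e l = e l' → l = l')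
    (hdvd : X ^ N ∣ ∑ l, C (γ l) * X ^ e l * u l) (l : ι) (hl : e l < N) : γ l = 0 := by
  induction hd : e l using Nat.strong_induction_on generalizing l with
  | _ d ih =>
    subst hd
    have h := X_pow_dvd_iff.mp hdvd _ hl
    rw [map_sum, Finset.sum_eq_single l] at h
    · rw [mul_assoc, coeff_C_mul, coeff_X_pow_mul', if_pos le_rfl, Nat.sub_self,
        coeff_zero_eq_constantCoeff] at h
      exact (mul_eq_zero.mp h).resolve_right (hu l)
    · intro l' _ hne
      rcases lt_trichotomy (e l') (e l) with hlt | heq | hgt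
      · rw [ih _ hlt l' (hlt.trans hl) rfl]
        simp
      · exact absurd (he l l' hl heq.symm).symm hne
      · rw [mul_assoc, coeff_C_mul, coeff_X_pow_mul', if_neg (by omega), mul_zero]
    · simp

/-- Last row of the Airy connection after pulling back by `z = t ^ n`, gauging by
`diag (t ^ (-m i))` and rescaling to order zero. -/
noncomputable def airyRow (n m : ℕ) (a b : ℕ → ℂ) (k : Fin n) : ℂ⟦X⟧ :=
  if (k : ℕ) = 0 then ∑ j ∈ Finset.range (m + 1), C (b j) * X ^ (n * (m - j))
  else C (a k) * X ^ (m * (n - k))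

/-- If the two characteristic polynomials agree at `y` modulo `X ^ (n + m)`, so do the
leading coefficients. -/
lemma coeffs_eq_of_airyRow {n q r m : ℕ} (hm2 : 2 ≤ m) (hq : 1 ≤ q) (hr0 : 0 < r) (hrm : r < m)
    (hn : n = q * m + r) (a d b h : ℕ → ℂ) {y : ℂ⟦X⟧} (hy : constantCoeff y ≠ 0)
    (hdvd : X ^ (n + m) ∣ ∑ k, airyRow n m a b k * y ^ (k : ℕ) -
      ∑ k, airyRow n m d h k * y ^ (k : ℕ)) :
    b m = h m ∧ b (m - 1) = h (m - 1) ∧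
      ∀ k : ℕ, 1 ≤ k → k ≤ q + 1 → a (n - k) = d (n - k) := by
  have hqm : q * 2 ≤ q * m := Nat.mul_le_mul_left q hm2
  have hqm' : 1 * m ≤ q * m := Nat.mul_le_mul_right m hq
  have hn0 : 0 < n := by omega
  let γ : Fin (m + 1) ⊕ Fin n → ℂ := Sum.elim (fun j => b j - h j)
    (fun k => if (k : ℕ) = 0 then 0 else a k - d k)
  let e : Fin (m + 1) ⊕ Fin n → ℕ := Sum.elim (fun j => n * (m - j)) (fun k => m * (n - k))
  let u : Fin (m + 1) ⊕ Fin n → ℂ⟦X⟧ := Sum.elim (fun _ => 1) (fun k => y ^ (k : ℕ))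
  have hrow : ∀ a b : ℕ → ℂ, ∑ k, airyRow n m a b k * y ^ (k : ℕ) =
      ∑ j : Fin (m + 1), C (b j) * X ^ (n * (m - j)) +
      ∑ k : Fin n, C (if (k : ℕ) = 0 then 0 else a k) * X ^ (m * (n - k)) * y ^ (k : ℕ) := by
    intro a b
    obtain ⟨n, rfl⟩ : ∃ n', n = n' + 1 := ⟨n - 1, by omega⟩
    rw [Fin.sum_univ_succ, Fin.sum_univ_succ (n := n), ← Finset.sum_range
      (fun j => C (b j) * X ^ ((n + 1) * (m - j)))]
    simp [airyRow]
  have hsum : ∑ k, airyRow n m a b k * y ^ (k : ℕ) - ∑ k, airyRow n m d h k * y ^ (k : ℕ) =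
      ∑ l, C (γ l) * X ^ e l * u l := by
    rw [hrow, hrow, Fintype.sum_sum_type, add_sub_add_comm, ← Finset.sum_sub_distrib,
      ← Finset.sum_sub_distrib]
    congr 1
    · refine Finset.sum_congr rfl fun j _ => ?_
      simp [γ, e, u, sub_mul]
    · refine Finset.sum_congr rfl fun k _ => ?_
      by_cases hk : (k : ℕ) = 0 <;> simp [γ, e, u, sub_mul, hk]
  rw [hsum] at hdvd
  have hu : ∀ l, constantCoeff (u l) ≠ 0 := by
    rintro (j | k)
    · simp [u]
    · simp [u, hy]
  have hnm : m * (q + 1) < n + m := by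
    rw [hn]; linarith [mul_comm m q, mul_add m q 1]
  have hnle : ∀ t, 2 ≤ t → n * 2 ≤ n * t := fun t ht => Nat.mul_le_mul_left n ht
  have hmlt : m < n := by omega
  have hnotdvd : ∀ t, n ≠ m * t := by
    intro t ht
    have h1 : m ∣ q * m + r := ⟨t, by rw [← hn, ht]⟩
    have h2 : m ∣ r := (Nat.dvd_add_right (Dvd.intro_left q rfl)).mp h1
    exact absurd (Nat.le_of_dvd hr0 h2) (by omega)
  have hmix : ∀ (j : Fin (m + 1)) (k : Fin n), n * (m - j) < n + m →
      n * (m - j) ≠ m * (n - k) := by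
    intro j k hj heq
    have hk := k.2
    have hpos : 0 < m * (n - k) := Nat.mul_pos (by omega) (by omega)
    rcases Nat.lt_or_ge 1 (m - (j : ℕ)) with h2 | h2
    · have := hnle _ h2
      omega
    · interval_cases hmj : m - (j : ℕ)
      · omega
      · exact hnotdvd (n - k) (by omega)
  have he : ∀ l l', e l < n + m → e l = e l' → l = l' := by
    rintro (j | k) (j' | k') hl heq
    · have := Nat.eq_of_mul_eq_mul_left hn0 heq
      have h1 := j.2
      have h2 := j'.2
      exact congrArg _ (Fin.ext (by omega))
    · exact absurd heq (hmix j k' hl)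
    · exact absurd heq.symm (hmix j' k (lt_of_eq_of_lt heq.symm hl))
    · have := Nat.eq_of_mul_eq_mul_left (by omega) heq
      have h1 := k.2
      have h2 := k'.2
      exact congrArg _ (Fin.ext (by omega))
  have key := eq_zero_of_X_pow_dvd_sum γ e u hu (n + m) he hdvd
  refine ⟨?_, ?_, ?_⟩
  · have := key (Sum.inl ⟨m, by omega⟩) (by simp [e]; omega)
    exact sub_eq_zero.mp this
  · have := key (Sum.inl ⟨m - 1, by omega⟩) (by
      have : m - (m - 1) = 1 := by omega
      simp [e, this]; omega)
    exact sub_eq_zero.mp this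
  · intro k hk1 hkq
    have hkn : k < n := by omega
    have hmk : m * k ≤ m * (q + 1) := Nat.mul_le_mul_left m hkq
    have := key (Sum.inr ⟨n - k, by omega⟩) (by
      have : n - (n - k) = k := by omega
      simp only [e, Sum.elim_inr, this]; omega)
    simp only [γ, Sum.elim_inr, if_neg (show n - k ≠ 0 by omega)] at this
    exact sub_eq_zero.mp this

end PowerSeriesRoots

section Laurent

open PowerSeries

lemma exists_ofPowerSeries_eq (f : LaurentSeries ℂ) (hf : ∀ s < 0, f.coeff s = 0) :
    ∃ g : ℂ⟦X⟧, HahnSeries.ofPowerSeries ℤ ℂ g = f := by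
  refine ⟨PowerSeries.mk fun s => f.coeff s, ?_⟩
  ext s
  rw [PowerSeries.coeff_coe]
  split_ifs with hs
  · exact (hf s hs).symm
  · rw [coeff_mk, Int.natAbs_of_nonneg (not_lt.mp hs)]

/-- A nonzero finite family of Laurent series has a common minimal order. -/
lemma exists_min_order {ι : Type*} [Finite ι] (R : ι → LaurentSeries ℂ) (hR : R ≠ 0) :
    ∃ e : ℤ, (∀ i, ∀ s < e, (R i).coeff s = 0) ∧ ∃ i, (R i).coeff e ≠ 0 := by
  obtain ⟨i₀, hi₀⟩ := Function.ne_iff.mp hR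
  obtain ⟨i, hi, hmin⟩ := Set.exists_min_image {i | R i ≠ 0} (fun i => (R i).order)
    (Set.toFinite _) ⟨i₀, hi₀⟩
  refine ⟨(R i).order, fun j s hs => ?_, i, HahnSeries.coeff_order_eq_zero.not.mpr hi⟩
  by_cases hj : R j = 0
  · simp [hj]
  · exact HahnSeries.coeff_eq_zero_of_lt_order (hs.trans_le (hmin j hj))

/-- The embedding `ℂ((z)) → ℂ((t))`, `z ↦ t ^ n`. -/
noncomputable def ramify (n : ℕ) (hn : 0 < n) : LaurentSeries ℂ →+* LaurentSeries ℂ :=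
  HahnSeries.embDomainRingHom (AddMonoidHom.mulLeft (n : ℤ))
    (fun a b hab => by
      have : (n : ℤ) ≠ 0 := by exact_mod_cast hn.ne'
      exact mul_left_cancel₀ this hab)
    (fun a b => by
      have : (0 : ℤ) < n := by exact_mod_cast hn
      exact mul_le_mul_iff_right₀ this)

variable {n : ℕ} (hn : 0 < n)

lemma ramify_single (s : ℤ) (c : ℂ) :
    ramify n hn (HahnSeries.single s c) = HahnSeries.single (n * s) c :=
  HahnSeries.embDomain_single

lemma ramify_coeff_mul (f : LaurentSeries ℂ) (s : ℤ) :
    (ramify n hn f).coeff (n * s) = f.coeff s :=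
  HahnSeries.embDomain_coeff

lemma exists_of_ramify_coeff_ne_zero {f : LaurentSeries ℂ} {s : ℤ}
    (hs : (ramify n hn f).coeff s ≠ 0) : ∃ l, s = n * l ∧ f.coeff l ≠ 0 := by
  by_contra! hcon
  refine hs (HahnSeries.embDomain_notin_image_support ?_)
  rintro ⟨l, hl, rfl⟩
  exact hl (hcon l rfl)

/-- The derivation lowers orders by at most `n` after ramification. -/
lemma ramify_lsDeriv_coeff {f : LaurentSeries ℂ} {e : ℤ}
    (hf : ∀ s < e, (ramify n hn f).coeff s = 0) {s : ℤ} (hs : s + n < e) :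
    (ramify n hn (lsDeriv f)).coeff s = 0 := by
  by_contra hne
  obtain ⟨l, rfl, hl⟩ := exists_of_ramify_coeff_ne_zero hn hne
  have h1 : f.coeff (l + 1) ≠ 0 := right_ne_zero_of_mul hl
  rw [← ramify_coeff_mul hn] at h1
  exact h1 (hf _ (by linarith))

/-- Pulling back the Airy connection by `z = t ^ n` and gauging by `diag (t ^ (-m i))` gives a
companion matrix of power series, up to scaling. -/
lemma single_mul_ramify_airyConn (m : ℕ) (a b : ℕ → ℂ) (i k : Fin n) :
    HahnSeries.single (2 * n + m + m * ((i : ℤ) - k)) 1 * ramify n hn (airyConn n m a b i k) =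
      HahnSeries.ofPowerSeries ℤ ℂ (lastRowCompanion (airyRow n m a b) i k) := by
  have hk := k.2
  simp only [airyConn, lastRowCompanion, Matrix.of_apply, airyRow]
  by_cases hi : (i : ℕ) + 1 = n
  · have hiz : (i : ℤ) = n - 1 := by omega
    rw [if_pos hi, if_pos hi]
    by_cases hk0 : (k : ℕ) = 0
    · simp only [if_pos hk0, map_sum, Finset.mul_sum]
      refine Finset.sum_congr rfl fun j hj => ?_
      have hj' : j ≤ m := by simpa [Nat.lt_succ_iff] using hj
      rw [ramify_single, map_mul, HahnSeries.ofPowerSeries_X_pow, HahnSeries.ofPowerSeries_C,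
        HahnSeries.C_apply, HahnSeries.single_mul_single, HahnSeries.single_mul_single, one_mul,
        mul_one, hiz, hk0]
      refine congrArg (fun s : ℤ => HahnSeries.single s _) ?_
      push_cast [hj']
      ring
    · simp only [if_neg hk0]
      rw [ramify_single, map_mul, HahnSeries.ofPowerSeries_X_pow, HahnSeries.ofPowerSeries_C,
        HahnSeries.C_apply, HahnSeries.single_mul_single, HahnSeries.single_mul_single, one_mul,
        mul_one, hiz]
      refine congrArg (fun s : ℤ => HahnSeries.single s _) ?_
      push_cast [hk.le]
      ring
  · rw [if_neg hi, if_neg hi]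
    by_cases hik : (i : ℕ) + 1 = k
    · rw [if_pos hik, if_pos hik, ramify_single, HahnSeries.single_mul_single, one_mul,
        map_one (HahnSeries.ofPowerSeries ℤ ℂ),
        ← HahnSeries.single_zero_one (Γ := ℤ)]
      have hkz : (k : ℤ) = i + 1 := by omega
      refine congrArg (fun s : ℤ => HahnSeries.single s (1 : ℂ)) ?_
      rw [hkz]
      ring
    · rw [if_neg hik, if_neg hik, map_zero, map_zero, mul_zero]

/-- A formal equivalence of Airy connections yields, after ramification and rescaling, a power
series matrix, nonzero at `t = 0`, intertwining the companion matrices modulo `t ^ (n + m)`. -/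
lemma exists_intertwiner {n : ℕ} (hn : 0 < n) (m : ℕ) (a b d h : ℕ → ℂ)
    (heq : FormallyEquiv (airyConn n m a b) (airyConn n m d h)) :
    ∃ Q : Matrix (Fin n) (Fin n) ℂ⟦X⟧, (∃ i j, constantCoeff (Q i j) ≠ 0) ∧
      ∀ i j, X ^ (n + m) ∣ (lastRowCompanion (airyRow n m a b) * Q -
        Q * lastRowCompanion (airyRow n m d h)) i j := by
  obtain ⟨P, hP⟩ := heq
  have hderiv : matDeriv P.1 = airyConn n m a b * P.1 - P.1 * airyConn n m d h := by
    rw [hP, mul_sub, ← mul_assoc, ← mul_assoc, ← mul_assoc, Units.mul_inv, one_mul, one_mul]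
    abel
  have hP0 : P.1 ≠ 0 := by
    have : Nonempty (Fin n) := ⟨⟨0, hn⟩⟩
    exact P.ne_zero
  let R : Fin n × Fin n → LaurentSeries ℂ := fun p =>
    HahnSeries.single (m * ((p.1 : ℤ) - p.2)) 1 * ramify n hn (P.1 p.1 p.2)
  have hR : R ≠ 0 := by
    intro hR
    refine hP0 (Matrix.ext fun i j => ?_)
    have := congrFun hR (i, j)
    have hs : HahnSeries.single ((m : ℤ) * ((i : ℤ) - j)) (1 : ℂ) ≠ 0 :=
      HahnSeries.single_ne_zero one_ne_zero
    exact (map_eq_zero_iff _ (ramify n hn).injective).mp ((mul_eq_zero.mp this).resolve_left hs)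
  obtain ⟨e, he, ⟨i₀, j₀⟩, hne⟩ := exists_min_order R hR
  have hQ : ∀ i j : Fin n, ∃ g : ℂ⟦X⟧, HahnSeries.ofPowerSeries ℤ ℂ g =
      HahnSeries.single (m * ((i : ℤ) - j) - e) 1 * ramify n hn (P.1 i j) := by
    intro i j
    refine exists_ofPowerSeries_eq _ fun s hs => ?_
    have := he (i, j) (s + e) (by omega)
    simp only [R, HahnSeries.coeff_single_mul, one_mul] at this ⊢
    rw [← this]
    congr 1
    ring
  choose Q hQ using hQ
  refine ⟨Matrix.of Q, ⟨i₀, j₀, ?_⟩, fun i j => ?_⟩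
  · have h0 := congrArg (fun f => HahnSeries.coeff f 0) (hQ i₀ j₀)
    simp only [PowerSeries.coeff_coe, HahnSeries.coeff_single_mul, one_mul] at h0
    simp only [R, HahnSeries.coeff_single_mul, one_mul] at hne
    simp only [lt_irrefl, if_false, Int.natAbs_zero, coeff_zero_eq_constantCoeff] at h0
    rw [Matrix.of_apply, h0, show (0 : ℤ) - (m * ((i₀ : ℤ) - j₀) - e) =
      e - m * ((i₀ : ℤ) - j₀) by ring]
    exact hne
  · have hcoe : HahnSeries.ofPowerSeries ℤ ℂ
        ((lastRowCompanion (airyRow n m a b) * Matrix.of Q -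
          Matrix.of Q * lastRowCompanion (airyRow n m d h)) i j) =
        HahnSeries.single (2 * n + m + m * ((i : ℤ) - j) - e) 1 *
          ramify n hn (lsDeriv (P.1 i j)) := by
      have hij : lsDeriv (P.1 i j) = _ := congrFun (congrFun hderiv i) j
      rw [hij, Matrix.sub_apply, Matrix.sub_apply, Matrix.mul_apply, Matrix.mul_apply,
        Matrix.mul_apply, Matrix.mul_apply]
      simp only [map_sub, map_sum, map_mul, mul_sub, Finset.mul_sum]
      congr 1
      · refine Finset.sum_congr rfl fun k _ => ?_
        rw [← single_mul_ramify_airyConn hn, Matrix.of_apply, hQ, mul_mul_mul_comm,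
          HahnSeries.single_mul_single, one_mul]
        congr 3
        ring
      · refine Finset.sum_congr rfl fun k _ => ?_
        rw [← single_mul_ramify_airyConn hn, Matrix.of_apply, hQ, mul_mul_mul_comm,
          HahnSeries.single_mul_single, one_mul]
        congr 3
        ring
    rw [X_pow_dvd_iff]
    intro s hs
    rw [← LaurentSeries.coeff_coe_powerSeries, hcoe, HahnSeries.coeff_single_mul, one_mul]
    refine ramify_lsDeriv_coeff hn (e := e - m * ((i : ℤ) - j)) (fun l hl => ?_) ?_
    · have := he (i, j) (l + m * ((i : ℤ) - j)) (by linarith)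
      simpa [R, HahnSeries.coeff_single_mul] using this
    · have : (s : ℤ) < n + m := by exact_mod_cast hs
      linarith

end Laurent

open PowerSeries in
lemma constantCoeff_airyRow {n m : ℕ} (hm : 0 < m) (hn : 0 < n) (a b : ℕ → ℂ) (k : Fin n) :
    constantCoeff (airyRow n m a b k) = if k = ⟨0, hn⟩ then b m else 0 := by
  by_cases hk : k = ⟨0, hn⟩
  · subst hk
    simp only [airyRow, if_true, map_sum, map_mul, map_pow, constantCoeff_C, constantCoeff_X]
    rw [Finset.sum_eq_single m]
    · simp
    · intro j hj hjm
      have hjm' : j < m := by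
        have := Finset.mem_range.mp hj
        omega
      rw [zero_pow (Nat.mul_pos hn (by omega)).ne', mul_zero]
    · simp
  · have hk0 : (k : ℕ) ≠ 0 := fun h => hk (Fin.ext h)
    have hpos : 0 < m * (n - k) := Nat.mul_pos hm (by omega)
    rw [if_neg hk, airyRow, if_neg hk0, map_mul, map_pow, constantCoeff_X, zero_pow hpos.ne',
      mul_zero]

/-- Case `n = qm + r`, `0 < r < m`: if two Airy connections of bidegree `(n, m)` are
formally equivalent over `ℂ((z))`, then `b_m = h_m`, `b_{m-1} = h_{m-1}` and
`a_{n-k} = d_{n-k}` for `1 ≤ k ≤ q + 1`. -/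
theorem airy_formallyEquiv_coeffs_of_n_eq_qm_add_r
    (n q r m : ℕ) (hm2 : 2 ≤ m) (hq : 1 ≤ q) (hr0 : 0 < r) (hrm : r < m)
    (hn : n = q * m + r)
    (a d : ℕ → ℂ) (b : ℕ → ℂ) (h : ℕ → ℂ) (hb : b m ≠ 0) (hh : h m ≠ 0)
    (heq : FormallyEquiv (airyConn n m a b) (airyConn n m d h)) :
    b m = h m ∧ b (m - 1) = h (m - 1) ∧
      ∀ k : ℕ, 1 ≤ k → k ≤ q + 1 → a (n - k) = d (n - k) := by
  have hqm : 1 * m ≤ q * m := Nat.mul_le_mul_right m hq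
  have hn0 : 0 < n := by omega
  obtain ⟨Q, ⟨i, j, hij⟩, hdvd⟩ := exists_intertwiner hn0 m a b d h heq
  obtain ⟨ρ, hρ, hsum⟩ := exists_pow_eq_sum_mul_pow_ne_zero (n := n) hh
    (fun j => PowerSeries.constantCoeff (Q i j)) (Function.ne_iff.mpr ⟨j, hij⟩)
  have hρ0 : ρ ≠ 0 := by
    rintro rfl
    exact hh (by rw [← hρ, zero_pow hn0.ne'])
  have hm0 : 0 < m := by omega
  obtain ⟨y, hyρ, hy⟩ := exists_powerSeries_root hn0 (airyRow n m d h) hρ0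
    (by rw [constantCoeff_airyRow hm0 hn0, if_pos rfl, hρ])
    (fun k hk => by rw [constantCoeff_airyRow hm0 hn0, if_neg hk])
  refine coeffs_eq_of_airyRow hm2 hq hr0 hrm hn a d b h (hyρ ▸ hρ0) ?_
  rw [← hy, ← Ideal.mem_span_singleton, ← Ideal.Quotient.mk_eq_mk_iff_sub_mem]
  set π := Ideal.Quotient.mk (Ideal.span {(PowerSeries.X : PowerSeries ℂ) ^ (n + m)}) with hπ
  have hcomp : ∀ c : Fin n → PowerSeries ℂ,
      (lastRowCompanion c).map π = lastRowCompanion fun k => π (c k) := by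
    intro c
    ext i j
    simp only [lastRowCompanion, Matrix.map_apply, Matrix.of_apply]
    split_ifs <;> simp
  have hint : lastRowCompanion (fun k => π (airyRow n m a b k)) * Q.map π =
      Q.map π * lastRowCompanion fun k => π (airyRow n m d h k) := by
    rw [← hcomp, ← hcomp, ← Matrix.map_mul, ← Matrix.map_mul]
    ext i j
    rw [Matrix.map_apply, Matrix.map_apply, hπ, Ideal.Quotient.mk_eq_mk_iff_sub_mem,
      Ideal.mem_span_singleton]
    exact hdvd i j
  have hunit : IsUnit ((Q.map π).mulVec (fun j => π y ^ (j : ℕ)) i) := by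
    have hu : IsUnit (∑ j, Q i j * y ^ (j : ℕ)) := by
      rw [PowerSeries.isUnit_iff_constantCoeff, isUnit_iff_ne_zero]
      simpa [hyρ] using hsum
    simpa [Matrix.mulVec, dotProduct] using hu.map π
  have hfinal := pow_eq_sum_of_intertwines _ _ (Q.map π) hint (y := π y)
    (by rw [← map_pow, hy]; simp) i hunit
  rw [map_pow, hfinal]
  simp
end

section
/- Let n ≥ 1, m ≥ 1, a₁, …, aₙ ∈ ℂ with aₙ = 1, and b₀, …, b_m ∈ ℂ. Suppose ξ ∈ ℂ((t)) is a nonzero formal Laurent series of t-order exactly −(n+m), with leading coefficient α₀ (the coefficient of t^{−(n+m)}), and suppose that ∑_{k=0}^{n} c_k(tⁿ)·ξ^{n−k} = 0 in ℂ((t)), where the c_k are the symbol coefficients of the Frobenius–Fuchs form of the Airy operator. Then α₀ⁿ = (−1)ⁿ b_m. -/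
open scoped BigOperators

/-- `σ_{h,j} = ∑_{1 ≤ r₁ < ⋯ < r_h ≤ j-1} r₁ r₂ ⋯ r_h`, with `σ_{0,j} = 1`. -/
noncomputable def sigmaFF (h j : ℕ) : ℂ :=
  ∑ s ∈ (Finset.Icc 1 (j - 1)).powersetCard h, ∏ i ∈ s, (i : ℂ)

/-- The symbol coefficients `c_k` of the Frobenius–Fuchs form of the Airy operator
`∑_{i=1}^n a_i ∂^i − ∑_{j=0}^m b_j x^j` (with `a_n = 1`), after the substitution `z = tⁿ`,
as formal Laurent series in `t`:
`c_k(tⁿ) = ∑_{i=0}^k (−1)^i a_{n−i} σ_{k−i,n−i} t^(−n i)` for `0 ≤ k ≤ n−1`, and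
`c_n(tⁿ) = (−1)^(n−1) ∑_{j=0}^m b_j t^(−n(n+j))`. -/
noncomputable def symbCoeff (n m : ℕ) (a b : ℕ → ℂ) (k : ℕ) : LaurentSeries ℂ :=
  if k = n then
    ∑ j ∈ Finset.range (m + 1),
      HahnSeries.single (-(n : ℤ) * ((n : ℤ) + (j : ℤ))) ((-1 : ℂ) ^ (n - 1) * b j)
  else
    ∑ i ∈ Finset.range (k + 1),
      HahnSeries.single (-(n : ℤ) * (i : ℤ))
        ((-1 : ℂ) ^ i * a (n - i) * sigmaFF (k - i) (n - i))

namespace HahnSeries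

theorem coeff_pow_nsmul_order {R : Type*} [CommRing R] [IsDomain R] (ξ : LaurentSeries R) (p : ℕ) :
    (ξ ^ p).coeff (p • ξ.order) = ξ.coeff ξ.order ^ p := by
  rw [← order_pow, ← leadingCoeff_eq, ← leadingCoeff_eq]
  induction p with
  | zero => simp
  | succ p ih => rw [pow_succ, leadingCoeff_mul, ih, pow_succ]

theorem coeff_pow_eq_zero_of_lt_nsmul_order {R : Type*} [CommRing R] [IsDomain R]
    (ξ : LaurentSeries R) (p : ℕ) {d : ℤ} (hd : d < p • ξ.order) : (ξ ^ p).coeff d = 0 :=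
  coeff_eq_zero_of_lt_order (by rwa [order_pow])

end HahnSeries

/-- If `ξ ∈ ℂ((t))` has `t`-order exactly `−(n+m)` with leading coefficient `α₀`, and
`∑_{k=0}^n c_k(tⁿ) ξ^(n−k) = 0`, then `α₀ⁿ = (−1)ⁿ b_m`. -/
theorem airy_leading_puiseux_coeff
    (n m : ℕ) (hn : 1 ≤ n) (hm : 1 ≤ m) (a b : ℕ → ℂ) (han : a n = 1)
    (ξ : LaurentSeries ℂ) (hξ : ξ ≠ 0) (hord : ξ.order = -((n : ℤ) + (m : ℤ)))
    (α₀ : ℂ) (hα : α₀ = ξ.coeff (-((n : ℤ) + (m : ℤ))))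
    (heq : ∑ k ∈ Finset.range (n + 1), symbCoeff n m a b k * ξ ^ (n - k) = 0) :
    α₀ ^ n = (-1 : ℂ) ^ n * b m := by
  have hcoeff := congrArg (fun f : LaurentSeries ℂ => f.coeff (-(n : ℤ) * (n + m))) heq
  simp only [HahnSeries.coeff_sum, HahnSeries.coeff_zero] at hcoeff
  have first : (symbCoeff n m a b 0 * ξ ^ (n - 0)).coeff (-(n : ℤ) * (n + m)) = α₀ ^ n := by
    have h := HahnSeries.coeff_pow_nsmul_order ξ n
    rw [hord, ← hα, nsmul_eq_mul, mul_neg, ← neg_mul] at h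
    simpa [symbCoeff, sigmaFF, (show 0 ≠ n by lia), han] using h
  have last : (symbCoeff n m a b n * ξ ^ (n - n)).coeff (-(n : ℤ) * (n + m))
      = (-1) ^ (n - 1) * b m := by
    rw [symbCoeff, if_pos rfl, Nat.sub_self, pow_zero, mul_one, HahnSeries.coeff_sum,
      Finset.sum_eq_single_of_mem m (by simp), HahnSeries.coeff_single_same]
    intro j _ hj
    refine HahnSeries.coeff_single_of_ne fun h => hj ?_
    have := mul_left_cancel₀ (show -(n : ℤ) ≠ 0 by lia) h
    lia
  have middle : ∀ k ∈ Finset.range (n + 1), k ≠ 0 ∧ k ≠ n →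
      (symbCoeff n m a b k * ξ ^ (n - k)).coeff (-(n : ℤ) * (n + m)) = 0 := by
    intro k hk ⟨hk0, hkn⟩
    have hkn' : k ≤ n := by simpa [Nat.lt_succ_iff] using hk
    rw [symbCoeff, if_neg hkn, Finset.sum_mul, HahnSeries.coeff_sum]
    refine Finset.sum_eq_zero fun i hi => ?_
    rw [HahnSeries.coeff_single_mul, HahnSeries.coeff_pow_eq_zero_of_lt_nsmul_order, mul_zero]
    rw [hord, nsmul_eq_mul, Nat.cast_sub hkn']
    have hi' : (i : ℤ) ≤ k := by
      rw [Finset.mem_range] at hi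
      lia
    have hmk : (0 : ℤ) < m * k := by positivity
    nlinarith [mul_le_mul_of_nonneg_left hi' (Int.natCast_nonneg n)]
  rw [Finset.sum_eq_add_of_mem 0 n (by simp) (by simp) (by lia) middle, first, last] at hcoeff
  obtain ⟨p, rfl⟩ := Nat.exists_eq_add_of_le' hn
  rw [Nat.add_sub_cancel] at hcoeff
  linear_combination hcoeff
end

section
/- For every integer k ≥ 2 there exists a polynomial g_k ∈ ℤ[X₀, X₁, …, X_{k−1}] of total degree at most k−2 such that for every commutative ring R equipped with a derivation d : R → R and every ξ ∈ R, one has ξ^{[k]} = ξᵏ + (k(k−1)/2)·ξ^{k−2}·d(ξ) + g_k(ξ, d(ξ), d²(ξ), …, d^{k−1}(ξ)), where k(k−1)/2 is the integer binomial coefficient. -/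
/-- `ξ^{[0]} = 1`, `ξ^{[k+1]} = ξ·ξ^{[k]} + d(ξ^{[k]})`. -/
def dBracket {R : Type*} [CommRing R] (d : Derivation ℤ R R) (ξ : R) : ℕ → R
  | 0 => 1
  | k + 1 => ξ * dBracket d ξ k + d (dBracket d ξ k)

namespace MvPolynomial

variable {A : Type*} [CommSemiring A]

theorem totalDegree_pderiv_le {σ : Type*} (i : σ) (p : MvPolynomial σ A) :
    (pderiv i p).totalDegree ≤ p.totalDegree - 1 := by
  refine Finset.sup_le fun m hm => ?_
  rw [mem_support_iff, coeff_pderiv] at hm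
  have h := le_totalDegree (mem_support_iff.2 (left_ne_zero_of_mul hm))
  rw [Finsupp.sum_add_index' (fun _ => rfl) (fun _ _ _ => rfl),
    Finsupp.sum_single_index rfl] at h
  lia

/-- The chain rule for a derivation applied to a polynomial expression. -/
theorem _root_.Derivation.map_mvPolynomial_aeval {σ B : Type*} [Fintype σ] [CommSemiring B]
    [Algebra A B] (d : Derivation A B B) (x : σ → B) (p : MvPolynomial σ A) :
    d (aeval x p) = ∑ i, aeval x (pderiv i p) * d (x i) := by
  classical
  induction p using MvPolynomial.induction_on with
  | C a => simp
  | add p q hp hq => simp [hp, hq, add_mul, Finset.sum_add_distrib]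
  | mul_X p j hp =>
    simp only [map_mul, aeval_X, Derivation.leibniz, smul_eq_mul, hp, pderiv_X, map_add, add_mul,
      Finset.sum_add_distrib, Finset.mul_sum, mul_assoc]
    congr 1
    rw [Finset.sum_eq_single j]
    · simp
    · intro b _ hb
      simp [hb.symm]
    · simp

/-- The total derivative on differential polynomials: the derivation sending `Xᵢ` to `Xᵢ₊₁`. -/
noncomputable def totalDeriv {k : ℕ} (p : MvPolynomial (Fin k) A) :
    MvPolynomial (Fin (k + 1)) A :=
  ∑ i, rename Fin.castSucc (pderiv i p) * X i.succ

theorem totalDegree_totalDeriv_le {k : ℕ} (p : MvPolynomial (Fin k) A) :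
    (totalDeriv p).totalDegree ≤ p.totalDegree := by
  refine totalDegree_finsetSum_le fun i _ => ?_
  rcases Nat.eq_zero_or_pos p.totalDegree with h | h
  · rw [totalDegree_eq_zero_iff_eq_C.1 h]
    simp
  · refine (totalDegree_mul _ _).trans ?_
    have h₁ := (totalDegree_rename_le Fin.castSucc (pderiv i p)).trans (totalDegree_pderiv_le i p)
    have h₂ : (X i.succ : MvPolynomial (Fin (k + 1)) A).totalDegree ≤ 1 := by
      simpa [X] using totalDegree_monomial_le (Finsupp.single i.succ 1) (1 : A)
    lia

theorem aeval_totalDeriv {B : Type*} [CommSemiring B] [Algebra A B] (d : Derivation A B B) (ξ : B)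
    {k : ℕ} (p : MvPolynomial (Fin k) A) :
    aeval (fun i : Fin (k + 1) => d^[(i : ℕ)] ξ) (totalDeriv p) =
      d (aeval (fun i : Fin k => d^[(i : ℕ)] ξ) p) := by
  simp only [totalDeriv, d.map_mvPolynomial_aeval, map_sum, map_mul, aeval_rename, aeval_X,
    Fin.val_succ, Function.iterate_succ_apply']
  rfl

end MvPolynomial

/-- For every `k ≥ 2` there is a polynomial `g_k ∈ ℤ[X₀,…,X_{k−1}]` of total degree at most
`k−2` such that, in every commutative ring with a derivation,
`ξ^{[k]} = ξᵏ + (k(k−1)/2)·ξ^(k−2)·d(ξ) + g_k(ξ, d(ξ), …, d^{k−1}(ξ))`. -/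
theorem dBracket_eq_pow_add_correction (k : ℕ) (hk : 2 ≤ k) :
    ∃ g : MvPolynomial (Fin k) ℤ, g.totalDegree ≤ k - 2 ∧
      ∀ (R : Type) (_ : CommRing R) (d : Derivation ℤ R R) (ξ : R),
        dBracket d ξ k =
          ξ ^ k + ((k * (k - 1) / 2 : ℕ) : R) * ξ ^ (k - 2) * d ξ +
            MvPolynomial.aeval (fun i : Fin k => (⇑d)^[(i : ℕ)] ξ) g := by
  induction k, hk using Nat.le_induction with
  | base =>
    refine ⟨0, by simp, fun R _ d ξ => ?_⟩
    simp [dBracket]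
    ring
  | succ k hk ih =>
    obtain ⟨g, hg, h⟩ := ih
    obtain ⟨n, rfl⟩ := Nat.exists_eq_add_of_le' hk
    have hc : (n + 2 + 1) * (n + 2 + 1 - 1) / 2 = (n + 2) * (n + 2 - 1) / 2 + (n + 2) := by
      rw [← Nat.choose_two_right, ← Nat.choose_two_right, Nat.choose_succ_succ' (n + 2) 1,
        Nat.choose_one_right, add_comm]
    rw [hc]
    generalize (n + 2) * (n + 2 - 1) / 2 = c at h
    let x (i : Fin (n + 2)) : MvPolynomial (Fin (n + 2)) ℤ := MvPolynomial.X i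
    let q := MvPolynomial.C (c : ℤ) * (x 0 ^ n * x 1) + g
    have hq : q.totalDegree ≤ n + 1 := by
      refine (MvPolynomial.totalDegree_add _ _).trans (max_le ?_ (by lia))
      refine (MvPolynomial.totalDegree_mul _ _).trans ?_
      have h₁ := MvPolynomial.totalDegree_mul (x 0 ^ n) (x 1)
      simp only [x, MvPolynomial.totalDegree_X_pow, MvPolynomial.totalDegree_X] at h₁
      rwa [MvPolynomial.totalDegree_C, zero_add]
    refine ⟨MvPolynomial.rename Fin.castSucc (x 0 * g) + MvPolynomial.totalDeriv q, ?_, ?_⟩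
    · refine (MvPolynomial.totalDegree_add _ _).trans (max_le ?_ ?_)
      · refine (MvPolynomial.totalDegree_rename_le _ _).trans ?_
        refine (MvPolynomial.totalDegree_mul _ _).trans ?_
        simp only [x, MvPolynomial.totalDegree_X]
        lia
      · exact (MvPolynomial.totalDegree_totalDeriv_le q).trans (by lia)
    · intro R _ d ξ
      rw [dBracket, h R _ d ξ, map_add (MvPolynomial.aeval _), MvPolynomial.aeval_totalDeriv,
        MvPolynomial.aeval_rename]
      simp [q, x, Function.comp_def, Derivation.leibniz_pow]
      ring
end
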